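/- arXiv:1403.1538 — 3 statements merged into one kernel-verified Lean document; each statement's English description precedes it below -/
import Mathlib

section
/- Let n = 2 and let W ∈ C¹(ℝᵐ;ℝ), m ≥ 1, be nonnegative with W(u) > 0 for all u ≠ a and W(a) = 0 for some a ∈ ℝᵐ. Assume there exists r₀ > 0 such that for every unit vector ν ∈ S^{m-1} the function r ↦ W(a + rν) is strictly increasing for r ∈ (0, r₀]. If u ∈ C²(ℝ²;ℝᵐ) is a bounded, globally minimizing solution of Δu = ∇W(u) on ℝ², then u ≡ a. -/
open MeasureTheory Metric Filter RealInnerProductSpace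

/-- Squared Frobenius norm of the gradient: `|∇u|² = Σᵢ |u_{xᵢ}|²`. -/
noncomputable def gradSq {n m : ℕ}
    (u : EuclideanSpace ℝ (Fin n) → EuclideanSpace ℝ (Fin m))
    (x : EuclideanSpace ℝ (Fin n)) : ℝ :=
  ∑ i : Fin n, ‖fderiv ℝ u x (EuclideanSpace.single i 1)‖ ^ 2

/-- The Laplacian of `u`, computed componentwise: `Δu = Σᵢ u_{xᵢxᵢ}`. -/
noncomputable def vlap {n m : ℕ}
    (u : EuclideanSpace ℝ (Fin n) → EuclideanSpace ℝ (Fin m))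
    (x : EuclideanSpace ℝ (Fin n)) : EuclideanSpace ℝ (Fin m) :=
  ∑ i : Fin n,
    fderiv ℝ (fun y => fderiv ℝ u y (EuclideanSpace.single i 1)) x (EuclideanSpace.single i 1)

/-- The Allen–Cahn energy `E(u;Ω) = ∫_Ω ((1/2)|∇u|² + W(u)) dx`. -/
noncomputable def energy {n m : ℕ} (W : EuclideanSpace ℝ (Fin m) → ℝ)
    (u : EuclideanSpace ℝ (Fin n) → EuclideanSpace ℝ (Fin m))
    (Ω : Set (EuclideanSpace ℝ (Fin n))) : ℝ :=
  ∫ x in Ω, ((1 / 2) * gradSq u x + W (u x))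

/-- `u` is a globally minimizing solution: for every bounded domain `Ω` and every
perturbation `φ ∈ W^{1,2}_0(Ω;ℝᵐ) ∩ L^∞(Ω;ℝᵐ)` (encoded as a Lipschitz, hence
bounded and `W^{1,2}`, function supported in `Ω`), `E(u;Ω) ≤ E(u+φ;Ω)`. -/
def GloballyMinimizing {n m : ℕ} (W : EuclideanSpace ℝ (Fin m) → ℝ)
    (u : EuclideanSpace ℝ (Fin n) → EuclideanSpace ℝ (Fin m)) : Prop :=
  ∀ Ω : Set (EuclideanSpace ℝ (Fin n)), IsOpen Ω → Bornology.IsBounded Ω →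
    ∀ φ : EuclideanSpace ℝ (Fin n) → EuclideanSpace ℝ (Fin m),
      (∃ K : NNReal, LipschitzWith K φ) → tsupport φ ⊆ Ω →
      energy W u Ω ≤ energy W (u + φ) Ω

/-- Energy density. -/
noncomputable def edens {m : ℕ} (W : EuclideanSpace ℝ (Fin m) → ℝ)
    (u : EuclideanSpace ℝ (Fin 2) → EuclideanSpace ℝ (Fin m))
    (x : EuclideanSpace ℝ (Fin 2)) : ℝ := (1 / 2) * gradSq u x + W (u x)

lemma gradSq_nonneg' {m : ℕ} (u : EuclideanSpace ℝ (Fin 2) → EuclideanSpace ℝ (Fin m))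
    (x : EuclideanSpace ℝ (Fin 2)) : 0 ≤ gradSq u x :=
  Finset.sum_nonneg fun _ _ => by positivity

lemma edens_continuous {m : ℕ} {W : EuclideanSpace ℝ (Fin m) → ℝ} (hW : Continuous W)
    {u : EuclideanSpace ℝ (Fin 2) → EuclideanSpace ℝ (Fin m)} (hu : ContDiff ℝ 1 u) :
    Continuous (edens W u) := by
  unfold edens gradSq
  have h := hu.continuous_fderiv (by norm_num)
  have h2 := hu.continuous
  fun_prop

lemma cont_intOn {f : EuclideanSpace ℝ (Fin 2) → ℝ} (hf : Continuous f)
    {s : Set (EuclideanSpace ℝ (Fin 2))} {R : ℝ} (hs : s ⊆ closedBall 0 R) :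
    IntegrableOn f s :=
  (hf.continuousOn.integrableOn_compact (isCompact_closedBall _ _)).mono_set hs

/-- The cutoff has bounded derivative. -/
lemma smoothTransition_deriv_bdd :
    ∃ K : ℝ, 0 < K ∧ ∀ t, |deriv Real.smoothTransition t| ≤ K := by
  have hc : Continuous (deriv Real.smoothTransition) :=
    (Real.smoothTransition.contDiff (n := 1)).continuous_deriv (by norm_num)
  obtain ⟨K, hK⟩ := isCompact_Icc.exists_bound_of_continuousOn (s := Set.Icc (0:ℝ) 1) hc.continuousOn
  refine ⟨max K 1, by positivity, fun t => ?_⟩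
  by_cases h0 : t < 0
  · have : Real.smoothTransition =ᶠ[nhds t] fun _ => 0 := by
      filter_upwards [Iio_mem_nhds h0] with s hs
      exact Real.smoothTransition.zero_of_nonpos (le_of_lt hs)
    rw [this.deriv_eq]; simp
  by_cases h1 : 1 < t
  · have : Real.smoothTransition =ᶠ[nhds t] fun _ => 1 := by
      filter_upwards [Ioi_mem_nhds h1] with s hs
      exact Real.smoothTransition.one_of_one_le (le_of_lt hs)
    rw [this.deriv_eq]; simp
  exact (hK t ⟨not_lt.1 h0, not_lt.1 h1⟩).trans (le_max_left _ _)

/-- Cutoffs. -/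
lemma exists_cutoff : ∃ K : ℝ, 0 < K ∧ ∀ r L : ℝ, 0 < L → L ≤ r →
    ∃ η : EuclideanSpace ℝ (Fin 2) → ℝ, ContDiff ℝ 1 η ∧ (∀ x, 0 ≤ η x ∧ η x ≤ 1) ∧
      (∀ x ∈ ball (0 : EuclideanSpace ℝ (Fin 2)) r, η x = 0) ∧
      (tsupport (fun x => η x - 1) ⊆ ball 0 (r + L)) ∧
      (∀ x ∈ ball (0 : EuclideanSpace ℝ (Fin 2)) (r + L), ‖fderiv ℝ η x‖ ≤ K / L) := by
  obtain ⟨K, hK, hd⟩ := smoothTransition_deriv_bdd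
  refine ⟨4 * K, by positivity, fun r L hL hLr => ?_⟩
  have hr : 0 < r := hL.trans_le hLr
  let p : EuclideanSpace ℝ (Fin 2) → ℝ := fun x => (‖x‖ ^ 2 - r ^ 2) / (L * r)
  have hp : ContDiff ℝ 1 p := ((contDiff_norm_sq ℝ).sub contDiff_const).div_const _
  refine ⟨fun x => Real.smoothTransition (p x), Real.smoothTransition.contDiff.comp hp,
    fun x => ⟨Real.smoothTransition.nonneg _, Real.smoothTransition.le_one _⟩, ?_, ?_, ?_⟩
  · intro x hx
    rw [mem_ball_zero_iff] at hx
    apply Real.smoothTransition.zero_of_nonpos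
    apply div_nonpos_of_nonpos_of_nonneg _ (by positivity)
    nlinarith [norm_nonneg x]
  · have hcl : IsClosed {x : EuclideanSpace ℝ (Fin 2) | ‖x‖ ^ 2 ≤ r ^ 2 + L * r} :=
      isClosed_le (by fun_prop) (by fun_prop)
    refine (closure_minimal ?_ hcl).trans ?_
    · intro x hx
      by_contra hcon
      apply hx
      simp only [Set.mem_setOf_eq, not_le] at hcon
      have : 1 ≤ p x := by
        rw [one_le_div (by positivity)]; linarith
      simp [Real.smoothTransition.one_of_one_le this]
    · intro x hx
      simp only [Set.mem_setOf_eq] at hx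
      rw [mem_ball_zero_iff]
      apply lt_of_pow_lt_pow_left₀ 2 (by positivity)
      nlinarith [mul_pos hL hr]
  · intro x hx
    rw [mem_ball_zero_iff] at hx
    have h1 : HasFDerivAt p ((L * r)⁻¹ • (2 • (innerSL ℝ x))) x := by
      have := ((hasStrictFDerivAt_norm_sq x).hasFDerivAt.sub_const (r ^ 2)).const_mul (L * r)⁻¹
      refine this.congr_of_eventuallyEq (Eventually.of_forall fun y => ?_)
      simp only [p]; rw [div_eq_inv_mul]
    have h2 : HasDerivAt Real.smoothTransition (deriv Real.smoothTransition (p x)) (p x) :=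
      ((Real.smoothTransition.contDiff (n := 1)).differentiable (by norm_num) _).hasDerivAt
    have h3 := h2.comp_hasFDerivAt x h1
    have h4 : fderiv ℝ (fun x => Real.smoothTransition (p x)) x = _ := h3.fderiv
    rw [h4, norm_smul]
    have h5 : ‖(L * r)⁻¹ • (2 • (innerSL ℝ x))‖ ≤ 4 / L := by
      rw [norm_smul]
      have : ‖(2 : ℕ) • (innerSL ℝ x)‖ ≤ 2 * (2 * r) := by
        refine (norm_nsmul_le).trans ?_
        rw [innerSL_apply_norm]
        push_cast; linarith
      rw [Real.norm_of_nonneg (by positivity)]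
      calc (L * r)⁻¹ * ‖(2 : ℕ) • (innerSL ℝ x)‖ ≤ (L * r)⁻¹ * (2 * (2 * r)) := by gcongr
        _ = 4 / L := by field_simp; norm_num
    calc _ ≤ K * (4 / L) := by
          apply mul_le_mul (hd _) h5 (norm_nonneg _) hK.le
      _ = 4 * K / L := by ring

/-- Pointwise comparison of energy densities. -/
lemma edens_comp {m : ℕ} {W : EuclideanSpace ℝ (Fin m) → ℝ} (a : EuclideanSpace ℝ (Fin m))
    (u : EuclideanSpace ℝ (Fin 2) → EuclideanSpace ℝ (Fin m)) (hu : ContDiff ℝ 1 u)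
    (η : EuclideanSpace ℝ (Fin 2) → ℝ) (hη : ContDiff ℝ 1 η) (x : EuclideanSpace ℝ (Fin 2))
    (C k : ℝ) (hC : 2 ≤ C) (h01 : 0 ≤ η x ∧ η x ≤ 1) (hk : ‖fderiv ℝ η x‖ ≤ k)
    (hWC : W (a + η x • (u x - a)) ≤ C * W (u x)) :
    edens W (u + fun y => (η y - 1) • (u y - a)) x
      ≤ C * edens W u x + 2 * k ^ 2 * ‖u x - a‖ ^ 2 := by
  have hv : (u + fun y => (η y - 1) • (u y - a)) = fun y => a + η y • (u y - a) := by
    funext y; simp only [Pi.add_apply]; module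
  rw [hv]
  have hux : HasFDerivAt u (fderiv ℝ u x) x := (hu.differentiable (by norm_num) x).hasFDerivAt
  have hηx : HasFDerivAt η (fderiv ℝ η x) x := (hη.differentiable (by norm_num) x).hasFDerivAt
  have hd := ((hηx.smul (hux.sub_const a)).const_add a).fderiv
  have hg : gradSq (fun y => a + η y • (u y - a)) x
      ≤ 2 * gradSq u x + 4 * k ^ 2 * ‖u x - a‖ ^ 2 := by
    have hi : ∀ i : Fin 2, ‖fderiv ℝ (fun y => a + η y • (u y - a)) x (EuclideanSpace.single i 1)‖ ^ 2
        ≤ 2 * ‖fderiv ℝ u x (EuclideanSpace.single i 1)‖ ^ 2 + 2 * k ^ 2 * ‖u x - a‖ ^ 2 := by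
      intro i
      have e1 : ‖fderiv ℝ (fun y => a + η y • (u y - a)) x (EuclideanSpace.single i 1)‖
          ≤ ‖fderiv ℝ u x (EuclideanSpace.single i 1)‖ + k * ‖u x - a‖ := by
        have hd' : fderiv ℝ (fun y => a + η y • (u y - a)) x = _ := hd
        rw [hd']
        simp only [ContinuousLinearMap.add_apply, ContinuousLinearMap.smul_apply,
          ContinuousLinearMap.smulRight_apply]
        refine (norm_add_le _ _).trans ?_
        rw [norm_smul, norm_smul]
        have e2 : ‖fderiv ℝ η x (EuclideanSpace.single i 1)‖ ≤ k := by
          refine ((fderiv ℝ η x).le_opNorm _).trans ?_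
          simpa using hk
        have e3 : ‖η x‖ ≤ 1 := by rw [Real.norm_of_nonneg h01.1]; exact h01.2
        gcongr
        exact mul_le_of_le_one_left (norm_nonneg _) e3
      have e4 := pow_le_pow_left₀ (norm_nonneg _) e1 2
      nlinarith [sq_nonneg (‖fderiv ℝ u x (EuclideanSpace.single i 1)‖ - k * ‖u x - a‖)]
    unfold gradSq
    simp only [Fin.sum_univ_two]
    have := hi 0
    have := hi 1
    linarith
  unfold edens
  have hg0 := gradSq_nonneg' u x
  nlinarith

lemma vol_annulus (r L : ℝ) (hL : 0 < L) (hLr : L ≤ r) :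
    volume.real (ball (0 : EuclideanSpace ℝ (Fin 2)) (r + L) \ ball 0 r)
      ≤ 3 * r * L * volume.real (ball (0 : EuclideanSpace ℝ (Fin 2)) 1) := by
  have hr : 0 < r := hL.trans_le hLr
  have hb : ∀ s : ℝ, 0 ≤ s → volume.real (ball (0 : EuclideanSpace ℝ (Fin 2)) s)
      = s ^ 2 * volume.real (ball (0 : EuclideanSpace ℝ (Fin 2)) 1) := by
    intro s hs
    rw [measureReal_def, Measure.addHaar_ball volume _ hs, ENNReal.toReal_mul, measureReal_def,
      finrank_euclideanSpace_fin, ENNReal.toReal_ofReal (by positivity)]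
  rw [measureReal_diff (ball_subset_ball (by linarith)) measurableSet_ball, hb _ hr.le,
    hb _ (by positivity)]
  have : 0 ≤ volume.real (ball (0 : EuclideanSpace ℝ (Fin 2)) 1) := measureReal_nonneg
  have h2 : (r + L) ^ 2 - r ^ 2 ≤ 3 * r * L := by nlinarith
  nlinarith

/-- Radial almost-monotonicity. -/
lemma W_star {m : ℕ} (W : EuclideanSpace ℝ (Fin m) → ℝ) (hW : Continuous W)
    (a : EuclideanSpace ℝ (Fin m))
    (hWa : W a = 0) (hWpos : ∀ v, v ≠ a → 0 < W v)
    (r₀ : ℝ) (hr₀ : 0 < r₀)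
    (hmono : ∀ ν : EuclideanSpace ℝ (Fin m), ‖ν‖ = 1 →
      StrictMonoOn (fun r : ℝ => W (a + r • ν)) (Set.Ioc 0 r₀)) (M : ℝ) :
    ∃ C : ℝ, 2 ≤ C ∧ ∀ (v : EuclideanSpace ℝ (Fin m)) (t : ℝ), ‖v - a‖ ≤ M → 0 ≤ t → t ≤ 1 → W (a + t • (v - a)) ≤ C * W v := by
  have hW0 : ∀ v, 0 ≤ W v := fun v => by
    by_cases h : v = a
    · rw [h, hWa]
    · exact (hWpos v h).le
  obtain ⟨B, hB⟩ := (isCompact_closedBall a M).exists_bound_of_continuousOn hW.continuousOn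
  have hcpt : IsCompact (closedBall a M \ ball a r₀) := (isCompact_closedBall a M).diff isOpen_ball
  obtain ⟨w, hw, hwle⟩ : ∃ w, 0 < w ∧ ∀ v ∈ closedBall a M \ ball a r₀, w ≤ W v := by
    rcases (closedBall a M \ ball a r₀).eq_empty_or_nonempty with h | h
    · exact ⟨1, one_pos, by simp [h]⟩
    · obtain ⟨z, hz, hmin⟩ := hcpt.exists_isMinOn h hW.continuousOn
      refine ⟨W z, hWpos z ?_, fun v hv => hmin hv⟩
      rintro rfl
      exact hz.2 (mem_ball_self hr₀)
  refine ⟨max 2 (B / w), le_max_left _ _, fun v t hv ht0 ht1 => ?_⟩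
  by_cases hva : v = a
  · simp [hva, hWa]
  have hpos : 0 < ‖v - a‖ := norm_pos_iff.2 (sub_ne_zero.2 hva)
  rcases lt_or_ge ‖v - a‖ r₀ with hlt | hge
  · have key : W (a + t • (v - a)) ≤ W v := by
      rcases ht0.eq_or_lt with rfl | ht
      · simp [hWa, hW0]
      have hν : ‖(‖v - a‖⁻¹ • (v - a))‖ = 1 := by
        rw [norm_smul, norm_inv, norm_norm, inv_mul_cancel₀ hpos.ne']
      have h := (hmono _ hν).monotoneOn (a := t * ‖v - a‖) (b := ‖v - a‖)
        ⟨by positivity, by nlinarith⟩ ⟨hpos, hlt.le⟩ (by nlinarith)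
      simp only [smul_smul, mul_assoc, mul_inv_cancel₀ hpos.ne', mul_one, one_smul] at h
      simpa using h
    have := hW0 v
    nlinarith [le_max_left 2 (B / w)]
  · have h1 := hwle v ⟨by rwa [mem_closedBall_iff_norm], by rw [mem_ball_iff_norm]; linarith⟩
    have h2 : W (a + t • (v - a)) ≤ B := by
      refine (le_abs_self _).trans (hB _ ?_)
      rw [mem_closedBall_iff_norm, add_sub_cancel_left, norm_smul, Real.norm_of_nonneg ht0]
      nlinarith
    have hB0 : 0 ≤ B := (hW0 _).trans h2
    calc W (a + t • (v - a)) ≤ B := h2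
      _ = B / w * w := by field_simp
      _ ≤ max 2 (B / w) * W v := by
        gcongr
        exact le_max_right _ _

lemma W_coer {m : ℕ} (W : EuclideanSpace ℝ (Fin m) → ℝ) (hW : Continuous W)
    (a : EuclideanSpace ℝ (Fin m))
    (hWa : W a = 0) (hWpos : ∀ v, v ≠ a → 0 < W v) (M : ℝ) (ε : ℝ) (hε : 0 < ε) :
    ∃ D : ℝ, 0 ≤ D ∧ ∀ v, ‖v - a‖ ≤ M → ‖v - a‖ ^ 2 ≤ ε + D * W v := by
  have hW0 : ∀ v, 0 ≤ W v := fun v => by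
    by_cases h : v = a
    · rw [h, hWa]
    · exact (hWpos v h).le
  have hcpt : IsCompact (closedBall a M ∩ {v | ε ≤ ‖v - a‖ ^ 2}) :=
    (isCompact_closedBall a M).inter_right (isClosed_le (by fun_prop) (by fun_prop))
  obtain ⟨w, hw, hwle⟩ : ∃ w, 0 < w ∧ ∀ v ∈ closedBall a M ∩ {v | ε ≤ ‖v - a‖ ^ 2}, w ≤ W v := by
    rcases (closedBall a M ∩ {v | ε ≤ ‖v - a‖ ^ 2}).eq_empty_or_nonempty with h | h
    · exact ⟨1, one_pos, by simp [h]⟩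
    · obtain ⟨z, hz, hmin⟩ := hcpt.exists_isMinOn h hW.continuousOn
      refine ⟨W z, hWpos z ?_, fun v hv => hmin hv⟩
      rintro rfl
      have := hz.2
      simp at this
      linarith
  refine ⟨M ^ 2 / w, by positivity, fun v hv => ?_⟩
  rcases lt_or_ge (‖v - a‖ ^ 2) ε with h | h
  · have := hW0 v
    have : 0 ≤ M ^ 2 / w * W v := by positivity
    linarith
  · have h1 := hwle v ⟨by rwa [mem_closedBall_iff_norm], h⟩
    calc ‖v - a‖ ^ 2 ≤ M ^ 2 := by gcongr
      _ = M ^ 2 / w * w := by field_simp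
      _ ≤ M ^ 2 / w * W v := by gcongr
      _ ≤ _ := by linarith

/-- The basic growth inequality. -/
lemma key_ineq {m : ℕ} (W : EuclideanSpace ℝ (Fin m) → ℝ) (hW : Continuous W)
    (a : EuclideanSpace ℝ (Fin m)) (hWa : W a = 0)
    (u : EuclideanSpace ℝ (Fin 2) → EuclideanSpace ℝ (Fin m))
    (hu : ContDiff ℝ 1 u) (hmin : GloballyMinimizing W u) (C : ℝ) (hC : 2 ≤ C)
    (hstar : ∀ x (t : ℝ), 0 ≤ t → t ≤ 1 → W (a + t • (u x - a)) ≤ C * W (u x)) :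
    ∃ K : ℝ, 0 < K ∧ ∀ r L : ℝ, 0 < L → L ≤ r →
      ∫ x in ball 0 (r + L), edens W u x ≤
        C * ((∫ x in ball 0 (r + L), edens W u x) - ∫ x in ball 0 r, edens W u x)
        + K / L ^ 2 * ∫ x in ball 0 (r + L) \ ball 0 r, ‖u x - a‖ ^ 2 := by
  obtain ⟨K, hK, hcut⟩ := exists_cutoff
  refine ⟨2 * K ^ 2, by positivity, fun r L hL hLr => ?_⟩
  obtain ⟨η, hη, h01, hz, hsupp, hder⟩ := hcut r L hL hLr
  let φ : EuclideanSpace ℝ (Fin 2) → EuclideanSpace ℝ (Fin m) := fun y => (η y - 1) • (u y - a)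
  have hφ : ContDiff ℝ 1 φ := (hη.sub contDiff_const).smul (hu.sub contDiff_const)
  have hsupp' : tsupport φ ⊆ ball 0 (r + L) :=
    (closure_mono (Function.support_smul_subset_left _ _)).trans hsupp
  have hcomp : HasCompactSupport φ :=
    (isCompact_closedBall (0 : EuclideanSpace ℝ (Fin 2)) (r + L)).of_isClosed_subset
      (isClosed_tsupport _) (hsupp'.trans ball_subset_closedBall)
  have hlip := hφ.lipschitzWith_of_hasCompactSupport hcomp (by norm_num)
  have hE := hmin (ball 0 (r + L)) isOpen_ball isBounded_ball φ hlip hsupp'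
  change ∫ x in ball 0 (r + L), edens W u x ≤ ∫ x in ball 0 (r + L), edens W (u + φ) x at hE
  have hcu := edens_continuous hW hu
  have hcv : Continuous (edens W (u + φ)) := edens_continuous hW (hu.add hφ)
  have hcn : Continuous fun x => ‖u x - a‖ ^ 2 := by
    have := hu.continuous
    fun_prop
  have hsub : ball (0 : EuclideanSpace ℝ (Fin 2)) r ⊆ ball 0 (r + L) :=
    ball_subset_ball (by linarith)
  have hbc : ball (0 : EuclideanSpace ℝ (Fin 2)) (r + L) ⊆ closedBall 0 (r + L) :=
    ball_subset_closedBall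
  have hdc : ball (0 : EuclideanSpace ℝ (Fin 2)) (r + L) \ ball 0 r ⊆ closedBall 0 (r + L) :=
    Set.diff_subset.trans hbc
  have hdu := setIntegral_diff (μ := volume) measurableSet_ball (cont_intOn hcu hbc) hsub
  have hdv := setIntegral_diff (μ := volume) measurableSet_ball (cont_intOn hcv hbc) hsub
  have hv0 : ∫ x in ball 0 r, edens W (u + φ) x = 0 := by
    rw [setIntegral_congr_fun (g := fun _ => (0 : ℝ)) measurableSet_ball, integral_zero]
    intro x hx
    have hev : (u + φ) =ᶠ[nhds x] fun _ => a := by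
      filter_upwards [isOpen_ball.mem_nhds hx] with y hy
      simp [φ, hz y hy]
    simp only [edens, gradSq, hev.fderiv_eq, hev.eq_of_nhds, hWa]
    simp
  have hle : ∫ x in ball 0 (r + L) \ ball 0 r, edens W (u + φ) x ≤
      ∫ x in ball 0 (r + L) \ ball 0 r,
        (C * edens W u x + 2 * (K / L) ^ 2 * ‖u x - a‖ ^ 2) := by
    apply setIntegral_mono_on (cont_intOn hcv hdc) (cont_intOn (by fun_prop) hdc)
      (measurableSet_ball.diff measurableSet_ball)
    intro x hx
    exact edens_comp a u hu η hη x C (K / L) hC (h01 x) (hder x hx.1)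
      (hstar x _ (h01 x).1 (h01 x).2)
  rw [integral_add ((cont_intOn hcu hdc).const_mul C) ((cont_intOn hcn hdc).const_mul _),
    integral_const_mul, integral_const_mul, hdu] at hle
  rw [hv0] at hdv
  have e : 2 * (K / L) ^ 2 = 2 * K ^ 2 / L ^ 2 := by ring
  rw [e] at hle
  linarith

/-- A monotone function satisfying the growth inequality is bounded. -/
lemma growth_bdd (E : ℝ → ℝ) (hE : Monotone E) (C C1 : ℝ) (hC : 0 < C) (hC1 : 0 < C1)
    (h : ∀ r L : ℝ, 0 < L → L ≤ r → E (r + L) ≤ C * (E (r + L) - E r) + C1 * (r / L))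
    (r : ℝ) (hr : 0 < r) : E r < 2 * C1 := by
  by_contra hcon
  push Not at hcon
  have hE0 : 0 < E r := by linarith
  set q : ℝ := 1 + 1 / (2 * C) with hq
  have hq1 : 1 < q := by
    have : 0 < 1 / (2 * C) := by positivity
    linarith
  set B : ℝ := 2 * C1 * q / (q - 1) with hB
  have hq1' : 0 < q - 1 := by linarith
  have hB0 : 0 < B := by positivity
  have step : ∀ k : ℕ, ∃ s, 0 < s ∧ s * Real.exp (B / E s) ≤ r * Real.exp (B / E r) ∧
      q ^ k * E r ≤ E s := by
    intro k
    induction k with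
    | zero => exact ⟨r, hr, le_rfl, by simp⟩
    | succ k ih =>
      obtain ⟨s, hs, hs1, hs2⟩ := ih
      have hEs : 2 * C1 ≤ E s := by
        have : 1 ≤ q ^ k := one_le_pow₀ hq1.le
        nlinarith
      have hEs0 : 0 < E s := by linarith
      set L := 2 * C1 * s / E s with hL
      have hL0 : 0 < L := by positivity
      have hLs : L ≤ s := by
        rw [hL, div_le_iff₀ hEs0]; nlinarith
      have hh := h s L hL0 hLs
      have h1 : C1 * (s / L) = E s / 2 := by rw [hL]; field_simp
      have hmon : E s ≤ E (s + L) := hE (by linarith)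
      have h2 : q * E s ≤ E (s + L) := by
        have h3 : E s / 2 ≤ C * (E (s + L) - E s) := by linarith
        have h4 : q * E s = E s + (E s / 2) / C := by rw [hq]; field_simp
        have h5 : E s / 2 / C ≤ E (s + L) - E s := by
          rw [div_le_iff₀ hC]; linarith
        linarith
      have hqE : 0 < q * E s := by positivity
      refine ⟨s + L, by positivity, ?_, ?_⟩
      · refine le_trans ?_ hs1
        have e1 : s + L = s * (2 * C1 / E s + 1) := by rw [hL]; ring
        calc (s + L) * Real.exp (B / E (s + L))
            ≤ (s * Real.exp (2 * C1 / E s)) * Real.exp (B / (q * E s)) := by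
              have := Real.add_one_le_exp (2 * C1 / E s)
              have g1 : s + L ≤ s * Real.exp (2 * C1 / E s) := by
                rw [e1]; exact mul_le_mul_of_nonneg_left this hs.le
              have g2 : B / E (s + L) ≤ B / (q * E s) := by gcongr
              gcongr
          _ = s * Real.exp (2 * C1 / E s + B / (q * E s)) := by rw [Real.exp_add]; ring
          _ = s * Real.exp (B / E s) := by
              congr 2
              rw [hB]
              field_simp
              ring
      · calc q ^ (k + 1) * E r = q * (q ^ k * E r) := by ring
          _ ≤ q * E s := by gcongr
          _ ≤ _ := h2
  obtain ⟨k, hk⟩ := pow_unbounded_of_one_lt (E (r * Real.exp (B / E r)) / E r) hq1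
  obtain ⟨s, hs, hs1, hs2⟩ := step k
  have hpos : 0 < E s := lt_of_lt_of_le (by positivity) hs2
  have h1 : s ≤ r * Real.exp (B / E r) := by
    refine le_trans ?_ hs1
    exact le_mul_of_one_le_right hs.le (Real.one_le_exp (by positivity))
  have h2 := hE h1
  rw [div_lt_iff₀ hE0] at hk
  linarith

/-- Theorem 1.3, Case (b), first part: for `n = 2`, if `r ↦ W(a + rν)` is strictly
increasing on `(0, r₀]` for every unit vector `ν`, then any bounded globally
minimizing solution is identically `a`. -/
theorem liouville_two_dim_strict_mono
    (m : ℕ) (hm : 1 ≤ m)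
    (W : EuclideanSpace ℝ (Fin m) → ℝ) (hW : ContDiff ℝ 1 W)
    (a : EuclideanSpace ℝ (Fin m))
    (hWa : W a = 0) (hWpos : ∀ v, v ≠ a → 0 < W v)
    (r₀ : ℝ) (hr₀ : 0 < r₀)
    (hmono : ∀ ν : EuclideanSpace ℝ (Fin m), ‖ν‖ = 1 →
      StrictMonoOn (fun r : ℝ => W (a + r • ν)) (Set.Ioc 0 r₀))
    (u : EuclideanSpace ℝ (Fin 2) → EuclideanSpace ℝ (Fin m))
    (hu : ContDiff ℝ 2 u)
    (hbdd : ∃ C, ∀ x, ‖u x‖ ≤ C)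
    (hsol : ∀ x, vlap u x = gradient W (u x))
    (hmin : GloballyMinimizing W u) :
    ∀ x, u x = a := by
  obtain ⟨C0, hC0⟩ := hbdd
  have hu1 : ContDiff ℝ 1 u := hu.of_le (by norm_num)
  have hWc := hW.continuous
  have hW0 : ∀ v, 0 ≤ W v := fun v => by
    by_cases h : v = a
    · rw [h, hWa]
    · exact (hWpos v h).le
  set M : ℝ := C0 + ‖a‖ with hM
  have hMu : ∀ x, ‖u x - a‖ ≤ M := fun x => (norm_sub_le _ _).trans (by linarith [hC0 x])
  have hM0 : 0 ≤ M := (norm_nonneg _).trans (hMu 0)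
  obtain ⟨C, hC, hstar⟩ := W_star W hWc a hWa hWpos r₀ hr₀ hmono M
  obtain ⟨K, hK, hkey⟩ := key_ineq W hWc a hWa u hu1 hmin C hC
    (fun x t h0 h1 => hstar (u x) t (hMu x) h0 h1)
  set E : ℝ → ℝ := fun r => ∫ x in ball 0 r, edens W u x with hEdef
  have hcu := edens_continuous hWc hu1
  have hnn : ∀ x, 0 ≤ edens W u x := fun x => by
    have := gradSq_nonneg' u x
    have := hW0 (u x)
    unfold edens
    positivity
  have hEmono : Monotone E := fun r s hrs =>
    setIntegral_mono_set (cont_intOn hcu ball_subset_closedBall)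
      (Eventually.of_forall hnn) (Eventually.of_forall (ball_subset_ball hrs))
  set ω : ℝ := volume.real (ball (0 : EuclideanSpace ℝ (Fin 2)) 1) with hω
  have hω0 : 0 ≤ ω := measureReal_nonneg
  have hcn : Continuous fun x => ‖u x - a‖ ^ 2 := by
    have := hu1.continuous
    fun_prop
  -- general annulus bound
  have hann : ∀ ε D : ℝ, 0 ≤ ε → 0 ≤ D → (∀ x, ‖u x - a‖ ^ 2 ≤ ε + D * W (u x)) →
      ∀ r L : ℝ, 0 < L → L ≤ r →
      ∫ x in ball 0 (r + L) \ ball 0 r, ‖u x - a‖ ^ 2 ≤ ε * (3 * r * L * ω) + D * E (r + L) := by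
    intro ε D hε hD hb r L hL hLr
    have hdc : ball (0 : EuclideanSpace ℝ (Fin 2)) (r + L) \ ball 0 r ⊆ closedBall 0 (r + L) :=
      Set.diff_subset.trans ball_subset_closedBall
    calc ∫ x in ball 0 (r + L) \ ball 0 r, ‖u x - a‖ ^ 2
        ≤ ∫ x in ball 0 (r + L) \ ball 0 r, (ε + D * edens W u x) := by
          apply setIntegral_mono_on (cont_intOn hcn hdc) (cont_intOn (by fun_prop) hdc)
            (measurableSet_ball.diff measurableSet_ball)
          intro x _
          refine (hb x).trans ?_
          have : W (u x) ≤ edens W u x := by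
            have := gradSq_nonneg' u x
            unfold edens
            linarith
          gcongr
      _ = ε * volume.real (ball (0 : EuclideanSpace ℝ (Fin 2)) (r + L) \ ball 0 r)
          + D * ∫ x in ball 0 (r + L) \ ball 0 r, edens W u x := by
          rw [integral_add (cont_intOn continuous_const hdc) ((cont_intOn hcu hdc).const_mul D),
            integral_const_mul, setIntegral_const, smul_eq_mul, mul_comm ε]
      _ ≤ ε * (3 * r * L * ω) + D * E (r + L) := by
          gcongr
          · exact vol_annulus r L hL hLr
          · exact setIntegral_mono_set (cont_intOn hcu ball_subset_closedBall)
              (Eventually.of_forall hnn) (Eventually.of_forall Set.diff_subset)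
  have hgrow : ∀ r L : ℝ, 0 < L → L ≤ r →
      E (r + L) ≤ C * (E (r + L) - E r) + (K * M ^ 2 * 3 * ω + 1) * (r / L) := by
    intro r L hL hLr
    have hr : 0 < r := hL.trans_le hLr
    have h1 := hkey r L hL hLr
    have h2 := hann (M ^ 2) 0 (by positivity) le_rfl
      (fun x => by simpa using pow_le_pow_left₀ (norm_nonneg _) (hMu x) 2) r L hL hLr
    have h3 : K / L ^ 2 * ∫ x in ball 0 (r + L) \ ball 0 r, ‖u x - a‖ ^ 2
        ≤ K / L ^ 2 * (M ^ 2 * (3 * r * L * ω) + 0 * E (r + L)) := by gcongr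
    have h4 : K / L ^ 2 * (M ^ 2 * (3 * r * L * ω) + 0 * E (r + L))
        = (K * M ^ 2 * 3 * ω) * (r / L) := by field_simp; ring
    have h5 : 0 < r / L := by positivity
    have h6 : E (r + L) ≤ C * (E (r + L) - E r) +
      K / L ^ 2 * ∫ x in ball 0 (r + L) \ ball 0 r, ‖u x - a‖ ^ 2 := h1
    linarith
  have hbd := growth_bdd E hEmono C (K * M ^ 2 * 3 * ω + 1) (by linarith) (by positivity) hgrow
  have hbdA : BddAbove (Set.range E) := by
    refine ⟨2 * (K * M ^ 2 * 3 * ω + 1), ?_⟩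
    rintro _ ⟨r, rfl⟩
    exact (hEmono (le_max_left r 1)).trans (hbd _ (by positivity)).le
  have hlim := tendsto_atTop_ciSup hEmono hbdA
  set S := ⨆ r, E r with hS
  have hSε : ∀ ε : ℝ, 0 < ε → S ≤ K * 3 * ω * ε := by
    intro ε hε
    obtain ⟨D, hD, hcoer⟩ := W_coer W hWc a hWa hWpos M ε hε
    have hlim2 : Tendsto (fun r : ℝ => E (r + r)) atTop (nhds S) :=
      hlim.comp (tendsto_id.atTop_add_atTop tendsto_id)
    have hinv : Tendsto (fun r : ℝ => (r ^ 2)⁻¹) atTop (nhds 0) :=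
      tendsto_inv_atTop_zero.comp (tendsto_pow_atTop (by norm_num))
    have hR : Tendsto (fun r : ℝ => C * (E (r + r) - E r) + K * 3 * ω * ε
        + K * D * ((r ^ 2)⁻¹ * E (r + r))) atTop
        (nhds (C * (S - S) + K * 3 * ω * ε + K * D * (0 * S))) :=
      (((hlim2.sub hlim).const_mul C).add_const _).add ((hinv.mul hlim2).const_mul _)
    have := le_of_tendsto_of_tendsto hlim2 hR (by
      filter_upwards [eventually_gt_atTop 0] with r hr
      have h1 : E (r + r) ≤ C * (E (r + r) - E r) +
        K / r ^ 2 * ∫ x in ball 0 (r + r) \ ball 0 r, ‖u x - a‖ ^ 2 := hkey r r hr le_rfl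
      have h2 := hann ε D hε.le hD (fun x => hcoer _ (hMu x)) r r hr le_rfl
      have h3 : K / r ^ 2 * ∫ x in ball 0 (r + r) \ ball 0 r, ‖u x - a‖ ^ 2
          ≤ K / r ^ 2 * (ε * (3 * r * r * ω) + D * E (r + r)) := by gcongr
      have h4 : K / r ^ 2 * (ε * (3 * r * r * ω) + D * E (r + r))
          = K * 3 * ω * ε + K * D * ((r ^ 2)⁻¹ * E (r + r)) := by field_simp
      linarith)
    simpa using this
  have hS0 : S ≤ 0 := by
    have ht : Tendsto (fun ε : ℝ => K * 3 * ω * ε) (nhdsWithin 0 (Set.Ioi 0)) (nhds 0) := by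
      have : Continuous fun ε : ℝ => K * 3 * ω * ε := by fun_prop
      have h := (this.tendsto 0).mono_left (nhdsWithin_le_nhds (s := Set.Ioi 0))
      simpa using h
    exact ge_of_tendsto ht (by filter_upwards [self_mem_nhdsWithin] with ε hε using hSε ε hε)
  intro x
  by_contra hx
  have hpos : 0 < edens W u x := by
    have := gradSq_nonneg' u x
    have := hWpos _ hx
    unfold edens
    positivity
  have hEpos : 0 < E (‖x‖ + 1) := by
    apply (setIntegral_pos_iff_support_of_nonneg_ae (Eventually.of_forall hnn)
      (cont_intOn hcu ball_subset_closedBall)).2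
    apply IsOpen.measure_pos
    · exact (hcu.isOpen_support).inter isOpen_ball
    · exact ⟨x, hpos.ne', by simp⟩
  have := le_ciSup hbdA (‖x‖ + 1)
  linarith
end

section
/- Let n = 2 and m = 1, and let W ∈ C¹(ℝ;ℝ) be nonnegative with W(u) > 0 for all u ≠ a and W(a) = 0 for some a ∈ ℝ. If u ∈ C²(ℝ²;ℝ) is a bounded, globally minimizing solution of Δu = W'(u) on ℝ², then u ≡ a. -/
open MeasureTheory Metric Filter

/-- Squared norm of the gradient of a scalar function: `|∇u|² = Σᵢ |u_{xᵢ}|²`. -/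
noncomputable def sgradSq {n : ℕ}
    (u : EuclideanSpace ℝ (Fin n) → ℝ)
    (x : EuclideanSpace ℝ (Fin n)) : ℝ :=
  ∑ i : Fin n, ‖fderiv ℝ u x (EuclideanSpace.single i 1)‖ ^ 2

/-- The Laplacian of a scalar function: `Δu = Σᵢ u_{xᵢxᵢ}`. -/
noncomputable def slap {n : ℕ}
    (u : EuclideanSpace ℝ (Fin n) → ℝ)
    (x : EuclideanSpace ℝ (Fin n)) : ℝ :=
  ∑ i : Fin n,
    fderiv ℝ (fun y => fderiv ℝ u y (EuclideanSpace.single i 1)) x (EuclideanSpace.single i 1)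

/-- The Allen–Cahn energy `E(u;Ω) = ∫_Ω ((1/2)|∇u|² + W(u)) dx`. -/
noncomputable def senergy {n : ℕ} (W : ℝ → ℝ)
    (u : EuclideanSpace ℝ (Fin n) → ℝ)
    (Ω : Set (EuclideanSpace ℝ (Fin n))) : ℝ :=
  ∫ x in Ω, ((1 / 2) * sgradSq u x + W (u x))

/-- `u` is a globally minimizing solution (scalar case). -/
def SGloballyMinimizing {n : ℕ} (W : ℝ → ℝ)
    (u : EuclideanSpace ℝ (Fin n) → ℝ) : Prop :=
  ∀ Ω : Set (EuclideanSpace ℝ (Fin n)), IsOpen Ω → Bornology.IsBounded Ω →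
    ∀ φ : EuclideanSpace ℝ (Fin n) → ℝ,
      (∃ K : NNReal, LipschitzWith K φ) → tsupport φ ⊆ Ω →
      senergy W u Ω ≤ senergy W (u + φ) Ω

/-- Linear radial cutoff, `1` on the ball of radius `R`, `0` outside the ball of radius `R+1`. -/
noncomputable def lcut (R : ℝ) (x : EuclideanSpace ℝ (Fin 2)) : ℝ :=
  max 0 (min 1 (R + 1 - ‖x‖))

lemma lcut_nonneg (R : ℝ) (x) : 0 ≤ lcut R x := le_max_left _ _

lemma lcut_le_one (R : ℝ) (x) : lcut R x ≤ 1 := max_le zero_le_one (min_le_left _ _)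

lemma lcut_eq_one {R : ℝ} {x} (h : ‖x‖ ≤ R) : lcut R x = 1 := by
  unfold lcut
  rw [min_eq_left (by linarith)]; simp

lemma lcut_eq_zero {R : ℝ} {x} (h : R + 1 ≤ ‖x‖) : lcut R x = 0 := by
  unfold lcut
  apply max_eq_left
  exact (min_le_right _ _).trans (by linarith)

lemma lcut_lip (R : ℝ) (x y) : |lcut R x - lcut R y| ≤ ‖x - y‖ := by
  unfold lcut
  have h1 := abs_max_sub_max_le_max (0:ℝ) (min 1 (R + 1 - ‖x‖)) 0 (min 1 (R + 1 - ‖y‖))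
  have h2 := abs_min_sub_min_le_max (1:ℝ) (R + 1 - ‖x‖) 1 (R + 1 - ‖y‖)
  have h3 := abs_norm_sub_norm_le x y
  have h4 : |R + 1 - ‖x‖ - (R + 1 - ‖y‖)| = |‖x‖ - ‖y‖| := by
    rw [abs_sub_comm ‖x‖]; congr 1; ring
  simp only [sub_self, abs_zero] at h1 h2
  have e : ∀ z : ℝ, max 0 |z| = |z| := fun z => max_eq_right (abs_nonneg z)
  rw [e] at h1 h2
  linarith

/-- The quadratic cutoff. -/
noncomputable def qcut (R : ℝ) (x : EuclideanSpace ℝ (Fin 2)) : ℝ := lcut R x ^ 2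

lemma qcut_nonneg (R : ℝ) (x) : 0 ≤ qcut R x := sq_nonneg _

lemma qcut_le_one (R : ℝ) (x) : qcut R x ≤ 1 :=
  pow_le_one₀ (lcut_nonneg R x) (lcut_le_one R x)

lemma qcut_eq_one {R : ℝ} {x} (h : ‖x‖ ≤ R) : qcut R x = 1 := by
  simp [qcut, lcut_eq_one h]

lemma qcut_eq_zero {R : ℝ} {x} (h : R + 1 ≤ ‖x‖) : qcut R x = 0 := by
  simp [qcut, lcut_eq_zero h]

lemma qcut_lip (R : ℝ) (x y) : |qcut R x - qcut R y| ≤ 2 * ‖x - y‖ := by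
  have h1 : qcut R x - qcut R y = (lcut R x + lcut R y) * (lcut R x - lcut R y) := by
    unfold qcut; ring
  rw [h1, abs_mul]
  have h2 := lcut_lip R x y
  have h3 : |lcut R x + lcut R y| ≤ 2 := by
    rw [abs_of_nonneg (add_nonneg (lcut_nonneg _ _) (lcut_nonneg _ _))]
    linarith [lcut_le_one R x, lcut_le_one R y]
  exact mul_le_mul h3 h2 (abs_nonneg _) (by norm_num)

lemma qcut_fderiv_norm (R : ℝ) (x) : ‖fderiv ℝ (qcut R) x‖ ≤ 2 * lcut R x := by
  apply le_of_forall_pos_le_add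
  intro ε hε
  apply norm_fderiv_le_of_lip'
  · linarith [lcut_nonneg R x]
  filter_upwards [Metric.ball_mem_nhds x hε] with y hy
  rw [mem_ball_iff_norm] at hy
  have h1 : qcut R y - qcut R x = (lcut R y + lcut R x) * (lcut R y - lcut R x) := by
    unfold qcut; ring
  have h2 := lcut_lip R y x
  have h4 := (abs_le.1 h2).2
  rw [h1, Real.norm_eq_abs, abs_mul,
    abs_of_nonneg (add_nonneg (lcut_nonneg _ _) (lcut_nonneg _ _))]
  exact mul_le_mul (by linarith) h2 (abs_nonneg _) (by linarith [lcut_nonneg R x])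

lemma qcut_fderiv_sq (R : ℝ) (x) (i : Fin 2) :
    (fderiv ℝ (qcut R) x (EuclideanSpace.single i 1)) ^ 2 ≤ 4 * qcut R x := by
  have h1 := (fderiv ℝ (qcut R) x).le_opNorm (EuclideanSpace.single i 1)
  have h2 := qcut_fderiv_norm R x
  simp only [PiLp.norm_single, norm_one, mul_one] at h1
  have h3 : ‖(fderiv ℝ (qcut R) x (EuclideanSpace.single i 1))‖ ^ 2 ≤ (2 * lcut R x) ^ 2 :=
    pow_le_pow_left₀ (norm_nonneg _) (h1.trans h2) 2
  rw [Real.norm_eq_abs, sq_abs] at h3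
  unfold qcut at h3 ⊢
  linarith

lemma qcut_fderiv_one {R : ℝ} {x} (h : ‖x‖ ≤ R) : fderiv ℝ (qcut R) x = 0 := by
  apply IsLocalMax.fderiv_eq_zero
  filter_upwards with y
  rw [qcut_eq_one h]; exact qcut_le_one R y

lemma qcut_fderiv_zero {R : ℝ} {x} (h : R + 1 ≤ ‖x‖) : fderiv ℝ (qcut R) x = 0 := by
  apply IsLocalMin.fderiv_eq_zero
  filter_upwards with y
  rw [qcut_eq_zero h]; exact qcut_nonneg R y

lemma alg_bound {p q g e : ℝ} (he0 : 0 ≤ e) (he1 : e ≤ 1) (hq : q ^ 2 ≤ 4 * e) :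
    ((1 - e) * p - g * q) ^ 2 ≤ p ^ 2 + 8 * g ^ 2 := by
  rcases he0.eq_or_lt with h | h
  · subst h
    have : q = 0 := by nlinarith
    subst this; nlinarith [sq_nonneg g]
  ·
    have h1 : q ^ 2 / e ≤ 4 := by rw [div_le_iff₀ h]; exact hq
    have h2 : -(2 * p * (g * q)) ≤ e * p ^ 2 + g ^ 2 * (q ^ 2 / e) := by
      have : 0 ≤ (e * p + g * q) ^ 2 / e := by positivity
      have h3 : (e * p + g * q) ^ 2 / e = e * p ^ 2 + 2 * p * (g * q) + g ^ 2 * (q ^ 2 / e) := by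
        field_simp; ring
      linarith
    have h4 : g ^ 2 * (q ^ 2 / e) ≤ g ^ 2 * 4 := mul_le_mul_of_nonneg_left h1 (sq_nonneg g)
    have h5 : g ^ 2 * q ^ 2 ≤ g ^ 2 * 4 := mul_le_mul_of_nonneg_left (by linarith) (sq_nonneg g)
    have h6 := mul_le_mul_of_nonneg_left (h2.trans (add_le_add_right h4 (e * p ^ 2))) (sub_nonneg.2 he1)
    have h7 : 0 ≤ e * p ^ 2 := by positivity
    have h8 : 0 ≤ e * (g ^ 2 * 4) := by positivity
    nlinarith

/-- The perturbation. -/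
noncomputable def pert (R t : ℝ) (u : EuclideanSpace ℝ (Fin 2) → ℝ)
    (x : EuclideanSpace ℝ (Fin 2)) : ℝ := - (qcut R x * max (u x - t) 0)

lemma pert_fderiv (R t : ℝ) (u : EuclideanSpace ℝ (Fin 2) → ℝ) (hu : Differentiable ℝ u) (x)
    (hd : DifferentiableAt ℝ (u + pert R t u) x) :
    (u x ≤ t → fderiv ℝ (u + pert R t u) x = fderiv ℝ u x) ∧
    (t < u x → fderiv ℝ (u + pert R t u) x =
      (1 - qcut R x) • fderiv ℝ u x - (u x - t) • fderiv ℝ (qcut R) x) := by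
  have hp : DifferentiableAt ℝ (pert R t u) x := by
    have := hd.sub (hu x)
    simpa using this
  have hadd : fderiv ℝ (u + pert R t u) x = fderiv ℝ u x + fderiv ℝ (pert R t u) x :=
    fderiv_add (hu x) hp
  constructor
  · intro h
    have : fderiv ℝ (pert R t u) x = 0 := by
      apply IsLocalMax.fderiv_eq_zero
      filter_upwards with y
      have h1 : pert R t u x = 0 := by
        unfold pert; rw [max_eq_right (by linarith)]; simp
      rw [h1]; unfold pert
      have := mul_nonneg (qcut_nonneg R y) (le_max_right (u y - t) 0)
      linarith
    rw [hadd, this, add_zero]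
  · intro h
    have hev : ∀ᶠ y in nhds x, t < u y := hu.continuous.continuousAt.eventually (lt_mem_nhds h)
    have hq : DifferentiableAt ℝ (qcut R) x := by
      have h1 : DifferentiableAt ℝ (fun y => - pert R t u y * (u y - t)⁻¹) x :=
        hp.neg.mul (((hu x).sub_const t).inv (by linarith))
      refine h1.congr_of_eventuallyEq ?_
      filter_upwards [hev] with y hy
      have h2 : u y - t ≠ 0 := by linarith
      unfold pert
      rw [max_eq_left (by linarith)]
      field_simp
    have h2 : pert R t u =ᶠ[nhds x] fun y => - (qcut R y * (u y - t)) := by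
      filter_upwards [hev] with y hy
      unfold pert
      rw [max_eq_left (by linarith)]
    have h3 := (hq.hasFDerivAt.mul ((hu x).hasFDerivAt.sub_const t)).neg
    rw [hadd, h2.fderiv_eq]
    have h4 : fderiv ℝ (fun y => - (qcut R y * (u y - t))) x = _ := h3.fderiv
    rw [h4]
    module

lemma sgradSq_nonneg' (u : EuclideanSpace ℝ (Fin 2) → ℝ) (x) : 0 ≤ sgradSq u x := by
  unfold sgradSq; positivity

lemma sgradSq_pert (R t : ℝ) (u : EuclideanSpace ℝ (Fin 2) → ℝ) (hu : Differentiable ℝ u) (x) :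
    sgradSq (u + pert R t u) x ≤ sgradSq u x + 16 * (max (u x - t) 0) ^ 2 ∧
    ((‖x‖ ≤ R ∨ R + 1 ≤ ‖x‖) → sgradSq (u + pert R t u) x ≤ sgradSq u x) := by
  by_cases hd : DifferentiableAt ℝ (u + pert R t u) x
  swap
  · have h0 : sgradSq (u + pert R t u) x = 0 := by
      unfold sgradSq
      simp [fderiv_zero_of_not_differentiableAt hd]
    rw [h0]
    have := sgradSq_nonneg' u x
    exact ⟨by positivity, fun _ => this⟩
  obtain ⟨h1, h2⟩ := pert_fderiv R t u hu x hd
  rcases le_or_gt (u x) t with h | h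
  · have h0 : sgradSq (u + pert R t u) x = sgradSq u x := by
      unfold sgradSq; rw [h1 h]
    rw [h0]
    exact ⟨by nlinarith [sq_nonneg (max (u x - t) 0)], fun _ => le_rfl⟩
  · have h3 := h2 h
    rw [max_eq_left (by linarith)]
    unfold sgradSq
    rw [h3]
    simp only [Fin.sum_univ_two, Real.norm_eq_abs, sq_abs, _root_.sub_apply,
      _root_.smul_apply, smul_eq_mul]
    constructor
    · have a0 := alg_bound (p := fderiv ℝ u x (EuclideanSpace.single 0 1)) (g := u x - t)
        (qcut_nonneg R x) (qcut_le_one R x) (qcut_fderiv_sq R x 0)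
      have a1 := alg_bound (p := fderiv ℝ u x (EuclideanSpace.single 1 1)) (g := u x - t)
        (qcut_nonneg R x) (qcut_le_one R x) (qcut_fderiv_sq R x 1)
      linarith
    · rintro (hx | hx)
      · rw [qcut_eq_one hx, qcut_fderiv_one hx]; simp; positivity
      · rw [qcut_eq_zero hx, qcut_fderiv_zero hx]; simp

lemma pert_abs (R t M : ℝ) (u : EuclideanSpace ℝ (Fin 2) → ℝ) (hM : ∀ x, max (u x - t) 0 ≤ M) (x) :
    |pert R t u x| ≤ M := by
  unfold pert
  rw [abs_neg, abs_of_nonneg (mul_nonneg (qcut_nonneg R x) (le_max_right _ _))]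
  calc _ ≤ 1 * max (u x - t) 0 := mul_le_mul_of_nonneg_right (qcut_le_one R x) (le_max_right _ _)
    _ ≤ M := by rw [one_mul]; exact hM x

lemma pert_zero {R t : ℝ} {u : EuclideanSpace ℝ (Fin 2) → ℝ} {x} (h : R + 1 ≤ ‖x‖) :
    pert R t u x = 0 := by
  simp [pert, qcut_eq_zero h]

lemma pert_lip (R t M : ℝ) (u : EuclideanSpace ℝ (Fin 2) → ℝ) (hu : ContDiff ℝ 1 u)
    (hM : ∀ x, max (u x - t) 0 ≤ M) : ∃ K : NNReal, LipschitzWith K (pert R t u) := by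
  have hM0 : 0 ≤ M := (le_max_right _ _).trans (hM 0)
  obtain ⟨L, hL⟩ := (hu.locallyLipschitz.locallyLipschitzOn
    (s := closedBall (0 : EuclideanSpace ℝ (Fin 2)) (R + 2))).exists_lipschitzOnWith_of_compact
      (isCompact_closedBall _ _)
  refine ⟨⟨L + 2 * M, by positivity⟩, LipschitzWith.of_dist_le_mul fun x y => ?_⟩
  rw [Real.dist_eq, dist_eq_norm]
  change _ ≤ (L + 2 * M) * ‖x - y‖
  have hLM : M * ‖x - y‖ ≤ (L + 2 * M) * ‖x - y‖ := by
    apply mul_le_mul_of_nonneg_right _ (norm_nonneg _)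
    have := L.2
    change 0 ≤ (L : ℝ) at this
    linarith
  have hpos : 0 ≤ (L + 2 * M) * ‖x - y‖ := by positivity
  have key : ∀ z w : EuclideanSpace ℝ (Fin 2), ‖z‖ < R + 1 → R + 2 < ‖w‖ → 1 ≤ ‖w - z‖ := by
    intro z w hz hw
    have := norm_sub_norm_le w z
    linarith
  by_cases hx : ‖x‖ ≤ R + 2 <;> by_cases hy : ‖y‖ ≤ R + 2
  · have h1 := hL.dist_le_mul x (by simpa using hx) y (by simpa using hy)
    rw [Real.dist_eq, dist_eq_norm] at h1
    have h2 : |max (u x - t) 0 - max (u y - t) 0| ≤ L * ‖x - y‖ := by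
      refine (abs_max_sub_max_le_abs _ _ _).trans ?_
      simpa using h1
    have h3 := qcut_lip R x y
    have e : pert R t u x - pert R t u y =
      -(qcut R x * (max (u x - t) 0 - max (u y - t) 0) + (qcut R x - qcut R y) * max (u y - t) 0) := by
      unfold pert; ring
    rw [e, abs_neg]
    refine (abs_add_le _ _).trans ?_
    rw [abs_mul, abs_mul, abs_of_nonneg (qcut_nonneg R x),
      abs_of_nonneg (le_max_right (u y - t) 0)]
    have h4 : qcut R x * |max (u x - t) 0 - max (u y - t) 0| ≤ 1 * (L * ‖x - y‖) :=
      mul_le_mul (qcut_le_one R x) h2 (abs_nonneg _) zero_le_one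
    have h5 : |qcut R x - qcut R y| * max (u y - t) 0 ≤ (2 * ‖x - y‖) * M :=
      mul_le_mul h3 (hM y) (le_max_right _ _) (by positivity)
    linarith
  · rw [pert_zero (x := y) (by linarith), sub_zero]
    by_cases hx' : ‖x‖ < R + 1
    · have := key x y hx' (by linarith)
      rw [norm_sub_rev] at this
      have h6 := pert_abs R t M u hM x
      nlinarith
    · rw [pert_zero (by linarith)]; simpa using hpos
  · rw [pert_zero (x := x) (by linarith), zero_sub, abs_neg]
    by_cases hx' : ‖y‖ < R + 1
    · have := key y x hx' (by linarith)
      have h6 := pert_abs R t M u hM y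
      nlinarith
    · rw [pert_zero (by linarith)]; simpa using hpos
  · rw [pert_zero (x := x) (by linarith), pert_zero (x := y) (by linarith)]
    simpa using hpos

lemma pert_tsupport (R t : ℝ) (u : EuclideanSpace ℝ (Fin 2) → ℝ) :
    tsupport (pert R t u) ⊆ ball 0 (R + 2) := by
  have h : tsupport (pert R t u) ⊆ closedBall 0 (R + 1) := by
    apply closure_minimal _ isClosed_closedBall
    intro x hx
    by_contra hc
    rw [mem_closedBall_zero_iff, not_le] at hc
    exact hx (pert_zero hc.le)
  exact h.trans (closedBall_subset_ball (by linarith))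

lemma sgradSq_cont (u : EuclideanSpace ℝ (Fin 2) → ℝ) (hu : ContDiff ℝ 1 u) :
    Continuous (sgradSq u) := by
  unfold sgradSq
  have := hu.continuous_fderiv (by norm_num)
  fun_prop

lemma sgradSq_meas (u : EuclideanSpace ℝ (Fin 2) → ℝ) : Measurable (sgradSq u) := by
  unfold sgradSq
  apply Finset.measurable_sum
  intro i _
  exact ((measurable_fderiv_apply_const ℝ u _).norm).pow_const 2

lemma step_ineq (W : ℝ → ℝ) (hW : Continuous W) (u : EuclideanSpace ℝ (Fin 2) → ℝ)
    (hu : ContDiff ℝ 1 u) (hmin : SGloballyMinimizing W u) (t M κ L : ℝ)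
    (hL : 0 ≤ L) (hM : ∀ x, max (u x - t) 0 ≤ M)
    (h1 : ∀ x, t < u x → κ * (u x - t) ≤ W (u x) - W t)
    (h2 : ∀ x, t < u x → ∀ s, t ≤ s → s ≤ u x → W s - W (u x) ≤ L * (u x - t)) (R : ℝ) :
    (κ + (8 * M + L)) * ∫ x in closedBall (0 : EuclideanSpace ℝ (Fin 2)) R, max (u x - t) 0 ≤
      (8 * M + L) * ∫ x in closedBall (0 : EuclideanSpace ℝ (Fin 2)) (R + 1), max (u x - t) 0 := by
  have hM0 : 0 ≤ M := (le_max_right _ _).trans (hM 0)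
  set K := 8 * M + L with hK
  set g : EuclideanSpace ℝ (Fin 2) → ℝ := fun x => max (u x - t) 0 with hg
  have hgc : Continuous g := by have := hu.continuous; fun_prop
  set Ω : Set (EuclideanSpace ℝ (Fin 2)) := ball 0 (R + 2) with hΩ
  set v := u + pert R t u with hv
  obtain ⟨Kφ, hKφ⟩ := pert_lip R t M u hu hM
  have hvc : Continuous v := hu.continuous.add hKφ.continuous
  have hE := hmin Ω isOpen_ball isBounded_ball (pert R t u) ⟨Kφ, hKφ⟩ (pert_tsupport R t u)
  rw [← hv] at hE
  set F : EuclideanSpace ℝ (Fin 2) → ℝ := fun x =>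
    (closedBall 0 (R + 1)).indicator (fun x => K * g x) x
      - (closedBall 0 R).indicator (fun x => (κ + K) * g x) x with hF
  have intC : ∀ f : EuclideanSpace ℝ (Fin 2) → ℝ, Continuous f → IntegrableOn f Ω := fun f hf =>
    (hf.continuousOn.integrableOn_compact (isCompact_closedBall 0 (R + 2))).mono_set
      ball_subset_closedBall
  have hFi1 : IntegrableOn ((closedBall 0 (R + 1)).indicator (fun x => K * g x)) Ω :=
    Integrable.indicator (intC _ (by fun_prop)) measurableSet_closedBall
  have hFi2 : IntegrableOn ((closedBall 0 R).indicator (fun x => (κ + K) * g x)) Ω :=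
    Integrable.indicator (intC _ (by fun_prop)) measurableSet_closedBall
  have hFi : IntegrableOn F Ω := hFi1.sub hFi2
  have hsu := sgradSq_cont u hu
  have hui : IntegrableOn (fun x => (1 / 2) * sgradSq u x + W (u x)) Ω :=
    intC _ (by have := hu.continuous; fun_prop)
  have hsv : IntegrableOn (sgradSq v) Ω := by
    refine Integrable.mono' (intC (fun x => sgradSq u x + 16 * g x ^ 2) (by fun_prop))
      (sgradSq_meas v).aestronglyMeasurable (ae_of_all _ fun x => ?_)
    rw [Real.norm_eq_abs, abs_of_nonneg (sgradSq_nonneg' v x)]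
    exact (sgradSq_pert R t u (hu.differentiable (by norm_num)) x).1
  have hvi : IntegrableOn (fun x => (1 / 2) * sgradSq v x + W (v x)) Ω :=
    (hsv.const_mul _).add (intC _ (by fun_prop))
  have hpt : ∀ x, (1 / 2) * sgradSq v x + W (v x) ≤ ((1 / 2) * sgradSq u x + W (u x)) + F x := by
    intro x
    obtain ⟨s1, s2⟩ := sgradSq_pert R t u (hu.differentiable (by norm_num)) x
    rw [← hv] at s1 s2
    have hg0 : 0 ≤ g x := le_max_right _ _
    have hgM : g x ≤ M := hM x
    have vdef : v x = u x - qcut R x * g x := by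
      simp only [hv, Pi.add_apply, pert, hg]; ring
    have hq0 := qcut_nonneg R x
    have hq1 := qcut_le_one R x
    have hWg : W (v x) - W (u x) ≤ L * g x := by
      rcases le_or_gt (u x) t with h | h
      · have : g x = 0 := max_eq_right (by linarith)
        rw [vdef, this]; simp
      · have hgx : g x = u x - t := max_eq_left (by linarith)
        rw [hgx]
        apply h2 x h
        · rw [vdef, hgx]; nlinarith
        · rw [vdef]; nlinarith
    have hWb : ‖x‖ ≤ R → W (v x) - W (u x) ≤ - κ * g x := by
      intro hx
      rcases le_or_gt (u x) t with h | h
      · have : g x = 0 := max_eq_right (by linarith)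
        rw [vdef, this]; simp
      · have hgx : g x = u x - t := max_eq_left (by linarith)
        have := h1 x h
        rw [vdef, qcut_eq_one hx, hgx]
        simp only [one_mul, sub_sub_cancel]
        linarith
    rcases le_or_gt ‖x‖ R with hx | hx
    · have e : F x = K * g x - (κ + K) * g x := by
        simp only [hF]
        rw [Set.indicator_of_mem, Set.indicator_of_mem] <;> simp <;> linarith
      rw [e]
      have := s2 (Or.inl hx)
      have := hWb hx
      linarith
    · rcases lt_or_ge (R + 1) ‖x‖ with hx' | hx'
      · have e : F x = 0 := by
          simp only [hF]
          rw [Set.indicator_of_notMem, Set.indicator_of_notMem] <;> simp <;> linarith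
        rw [e]
        have := s2 (Or.inr hx'.le)
        rw [vdef, qcut_eq_zero hx'.le]
        simp; linarith
      · have e : F x = K * g x := by
          simp only [hF]
          rw [Set.indicator_of_mem, Set.indicator_of_notMem] <;> simp <;> linarith
        rw [e, hK]
        change sgradSq v x ≤ sgradSq u x + 16 * g x ^ 2 at s1
        nlinarith
  have hfin : senergy W v Ω ≤ senergy W u Ω + ∫ x in Ω, F x := by
    unfold senergy
    rw [← integral_add hui hFi]
    exact setIntegral_mono hvi (hui.add hFi) hpt
  have hFint : ∫ x in Ω, F x = K * (∫ x in closedBall 0 (R + 1), g x)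
      - (κ + K) * ∫ x in closedBall 0 R, g x := by
    simp only [hF]
    rw [integral_sub hFi1 hFi2, setIntegral_indicator measurableSet_closedBall,
      setIntegral_indicator measurableSet_closedBall,
      Set.inter_eq_right.2 (closedBall_subset_ball (by linarith)),
      Set.inter_eq_right.2 (closedBall_subset_ball (by linarith)),
      integral_const_mul, integral_const_mul]
  linarith

lemma growth (M : ℝ) (g : EuclideanSpace ℝ (Fin 2) → ℝ) (hg : Continuous g) (hg0 : ∀ x, 0 ≤ g x)
    (hM : ∀ x, g x ≤ M) (κ K : ℝ) (hκ : 0 < κ) (hK : 0 < K)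
    (h : ∀ R : ℝ, (κ + K) * ∫ x in closedBall (0 : EuclideanSpace ℝ (Fin 2)) R, g x ≤
      K * ∫ x in closedBall (0 : EuclideanSpace ℝ (Fin 2)) (R + 1), g x) : ∀ x, g x = 0 := by
  intro x₀
  by_contra hne
  have hpos : 0 < g x₀ := lt_of_le_of_ne (hg0 x₀) (Ne.symm hne)
  obtain ⟨N, hN⟩ := exists_nat_gt ‖x₀‖
  set G : ℕ → ℝ := fun n => ∫ x in closedBall (0 : EuclideanSpace ℝ (Fin 2)) n, g x with hG
  have hGN : 0 < G N := by
    simp only [hG]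
    rw [setIntegral_pos_iff_support_of_nonneg_ae (ae_of_all _ hg0)
      (hg.continuousOn.integrableOn_compact (isCompact_closedBall _ _))]
    have ho : IsOpen (Function.support g ∩ ball (0 : EuclideanSpace ℝ (Fin 2)) N) :=
      (hg.isOpen_support).inter isOpen_ball
    refine lt_of_lt_of_le (ho.measure_pos volume ⟨x₀, hne, by simpa using hN⟩) ?_
    exact measure_mono (Set.inter_subset_inter_right _ ball_subset_closedBall)
  set q := (κ + K) / K with hq
  have hq1 : 1 < q := by rw [hq, one_lt_div hK]; linarith
  have hstep : ∀ n : ℕ, q * G n ≤ G (n + 1) := by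
    intro n
    have := h n
    simp only [hG, hq]
    push_cast
    rw [div_mul_eq_mul_div, div_le_iff₀ hK]
    linarith
  have hit : ∀ n : ℕ, q ^ n * G N ≤ G (N + n) := by
    intro n
    induction n with
    | zero => simp
    | succ k ih =>
      calc q ^ (k + 1) * G N = q * (q ^ k * G N) := by ring
        _ ≤ q * G (N + k) := mul_le_mul_of_nonneg_left ih (by linarith)
        _ ≤ _ := hstep _
  set c := volume.real (ball (0 : EuclideanSpace ℝ (Fin 2)) 1) with hc
  have hup : ∀ n : ℕ, G n ≤ M * c * (n : ℝ) ^ 2 := by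
    intro n
    have h1 : G n ≤ ∫ x in closedBall (0 : EuclideanSpace ℝ (Fin 2)) n, M :=
      setIntegral_mono (hg.continuousOn.integrableOn_compact (isCompact_closedBall _ _))
        (continuous_const.continuousOn.integrableOn_compact (isCompact_closedBall _ _)) hM
    rw [setIntegral_const, smul_eq_mul, Measure.addHaar_real_closedBall _ _ (by positivity)] at h1
    simp only [finrank_euclideanSpace, Fintype.card_fin] at h1
    rw [← hc] at h1
    linarith
  have hlim := tendsto_pow_const_div_const_pow_of_one_lt 2 hq1
  have hlim2 := hlim.const_mul (M * c * q ^ N)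
  rw [mul_zero] at hlim2
  have hlim3 := (Filter.tendsto_add_atTop_iff_nat N).2 hlim2
  have : G N ≤ 0 := by
    refine ge_of_tendsto hlim3 (Filter.Eventually.of_forall fun n => ?_)
    have a1 := (hit n).trans (hup (N + n))
    have hqn : 0 < q ^ n := by positivity
    have a2 : M * c * q ^ N * (((n + N : ℕ) : ℝ) ^ 2 / q ^ (n + N))
      = M * c * ((N + n : ℕ) : ℝ) ^ 2 / q ^ n := by
      rw [pow_add, add_comm n N]
      field_simp
    rw [a2, le_div_iff₀ hqn]
    linarith
  linarith

lemma upper_bound (W : ℝ → ℝ) (hW : ContDiff ℝ 1 W)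
    (a : ℝ) (hWa : W a = 0) (hWpos : ∀ v : ℝ, v ≠ a → 0 < W v)
    (u : EuclideanSpace ℝ (Fin 2) → ℝ) (hu : ContDiff ℝ 1 u)
    (hbdd : ∃ C, ∀ x, |u x| ≤ C) (hmin : SGloballyMinimizing W u) :
    ∀ x, u x ≤ a := by
  obtain ⟨C, hC⟩ := hbdd
  set B := max C a + 1 with hB
  have haB : a < B := by have := le_max_right C a; linarith
  have huB : ∀ x, u x ≤ B := fun x => by
    have := le_max_left C a; have := (abs_le.1 (hC x)).2; linarith
  obtain ⟨L, hL⟩ := (hW.locallyLipschitz.locallyLipschitzOn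
    (s := Set.Icc a B)).exists_lipschitzOnWith_of_compact isCompact_Icc
  have key : ∀ κ : ℝ, 0 < κ → ∃ t ∈ Set.Icc a B, W t ≤ κ * (B - a) ∧ ∀ x, u x ≤ t := by
    intro κ hκ
    obtain ⟨t, ht, htm⟩ := isCompact_Icc.exists_isMinOn (Set.nonempty_Icc.2 haB.le)
      (f := fun s => W s - κ * s) (by have := hW.continuous; fun_prop)
    have hmn : ∀ s ∈ Set.Icc a B, W t - κ * t ≤ W s - κ * s := fun s hs => htm hs
    refine ⟨t, ht, ?_, ?_⟩
    · have := hmn a ⟨le_rfl, haB.le⟩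
      have := ht.2
      nlinarith
    · have hL0 : (0:ℝ) ≤ L := L.2
      have hM : ∀ x, max (u x - t) 0 ≤ B - a := fun x =>
        max_le (by linarith [huB x, ht.1]) (by linarith)
      have hst := step_ineq W hW.continuous u hu hmin t (B - a) κ L hL0 hM
        (fun x hx => by
          have := hmn (u x) ⟨by linarith [ht.1], huB x⟩
          linarith)
        (fun x hx s hs1 hs2 => by
          have h3 := hL.dist_le_mul s ⟨by linarith [ht.1], by linarith [huB x]⟩ (u x)
            ⟨by linarith [ht.1], huB x⟩
          rw [Real.dist_eq, Real.dist_eq, abs_sub_comm s, abs_of_nonneg (by linarith : 0 ≤ u x - s)] at h3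
          have h4 := (abs_le.1 h3).2
          have : (L : ℝ) * (u x - s) ≤ L * (u x - t) :=
            mul_le_mul_of_nonneg_left (by linarith) hL0
          linarith)
      have hz := growth (B - a) (fun x => max (u x - t) 0)
        (by have := hu.continuous; fun_prop) (fun x => le_max_right _ _) hM κ (8 * (B - a) + L) hκ
        (by linarith) hst
      intro x
      have h5 := le_max_left (u x - t) 0
      have h6 : max (u x - t) 0 = 0 := hz x
      linarith
  intro x
  by_contra hx
  push Not at hx
  obtain ⟨s, hs, hsm⟩ := (isCompact_Icc (a := u x) (b := B)).exists_isMinOn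
    (Set.nonempty_Icc.2 (huB x)) (f := W) hW.continuous.continuousOn
  have hWs : 0 < W s := hWpos s (by have := hs.1; intro h; linarith)
  have hBa : 0 < B - a := by linarith
  obtain ⟨t, ht, ht1, ht2⟩ := key (W s / (2 * (B - a))) (by positivity)
  have h7 : W s ≤ W t := hsm ⟨ht2 x, ht.2⟩
  have h8 : W s / (2 * (B - a)) * (B - a) = W s / 2 := by
    have : B - a ≠ 0 := by linarith
    field_simp
  linarith

lemma sgradSq_neg (u : EuclideanSpace ℝ (Fin 2) → ℝ) (x) : sgradSq (-u) x = sgradSq u x := by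
  unfold sgradSq
  simp [fderiv_neg]

lemma min_neg (W : ℝ → ℝ) (u : EuclideanSpace ℝ (Fin 2) → ℝ) (h : SGloballyMinimizing W u) :
    SGloballyMinimizing (fun s => W (-s)) (-u) := by
  have e : ∀ w Ω, senergy (fun s => W (-s)) (-w : EuclideanSpace ℝ (Fin 2) → ℝ) Ω = senergy W w Ω := by
    intro w Ω
    unfold senergy
    simp [sgradSq_neg]
  intro Ω hΩ hb φ ⟨K, hφ⟩ hs
  have h1 := h Ω hΩ hb (-φ) ⟨K, hφ.neg⟩ (by
    have : Function.support (-φ) = Function.support φ := Function.support_neg φ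
    unfold tsupport at hs ⊢
    rwa [this])
  rw [e, show -u + φ = -(u + -φ) by abel, e]
  exact h1

/-- Theorem 1.3, Case (b), last part: for `n = 2` and `m = 1`, any bounded globally
minimizing solution of `Δu = W'(u)` is identically `a`. -/
theorem liouville_two_dim_scalar
    (W : ℝ → ℝ) (hW : ContDiff ℝ 1 W)
    (a : ℝ) (hWa : W a = 0) (hWpos : ∀ v : ℝ, v ≠ a → 0 < W v)
    (u : EuclideanSpace ℝ (Fin 2) → ℝ)
    (hu : ContDiff ℝ 2 u)
    (hbdd : ∃ C, ∀ x, |u x| ≤ C)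
    (hsol : ∀ x, slap u x = deriv W (u x))
    (hmin : SGloballyMinimizing W u) :
    ∀ x, u x = a := by

  have hu1 : ContDiff ℝ 1 u := hu.of_le (by norm_num)
  intro x
  apply le_antisymm
  · exact upper_bound W hW a hWa hWpos u hu1 hbdd hmin x
  · have h := upper_bound (fun s => W (-s)) (hW.comp contDiff_neg) (-a) (by simpa using hWa)
      (fun v hv => hWpos (-v) (by intro h; apply hv; linarith)) (-u) hu1.neg
      (by simpa using hbdd) (min_neg W u hmin) x
    simp only [Pi.neg_apply] at h
    linarith
end

section
/- Let W ∈ C²(ℝᵐ;ℝ), m ≥ 1, be nonnegative with W(u) > 0 for all u ≠ a and W(a) = 0 for some a ∈ ℝᵐ, and assume the Hessian of W at a is positive definite, i.e. W_{uu}(a)ν · ν > 0 for every unit vector ν ∈ S^{m-1}. If u ∈ C²(ℝⁿ;ℝᵐ), n ≥ 2, is a bounded, globally minimizing solution of Δu = ∇W(u) on ℝⁿ, then u ≡ a. -/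
open MeasureTheory Metric Filter RealInnerProductSpace

lemma aux_grad_deriv {m : ℕ} (W : EuclideanSpace ℝ (Fin m) → ℝ) (hW : ContDiff ℝ 2 W) :
    ContDiff ℝ 1 (fun v => gradient W v) := by
  have h1 : ContDiff ℝ 1 (fderiv ℝ W) := hW.fderiv_right (by norm_num)
  unfold gradient
  exact (InnerProductSpace.toDual ℝ (EuclideanSpace ℝ (Fin m))).symm.contDiff.comp h1

lemma aux_line {m : ℕ} (W : EuclideanSpace ℝ (Fin m) → ℝ) (hW : ContDiff ℝ 2 W)
    (a h : EuclideanSpace ℝ (Fin m)) (t : ℝ) :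
    HasDerivAt (fun t : ℝ => W (a + t • h)) ⟪gradient W (a + t • h), h⟫ t := by
  have h1 : HasFDerivAt W (fderiv ℝ W (a + t • h)) (a + t • h) :=
    (hW.differentiable (by norm_num) _).hasFDerivAt
  have h2 : HasDerivAt (fun t : ℝ => a + t • h) h t := by
    simpa using ((hasDerivAt_id t).smul_const h).const_add a
  have h3 := h1.comp_hasDerivAt t h2
  have : fderiv ℝ W (a + t • h) h = ⟪gradient W (a + t • h), h⟫ := by
    simp [gradient]
  rw [← this]
  exact h3

lemma aux_grad_zero {m : ℕ} (W : EuclideanSpace ℝ (Fin m) → ℝ)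
    (a : EuclideanSpace ℝ (Fin m))
    (hWa : W a = 0) (hWpos : ∀ v, v ≠ a → 0 < W v) : gradient W a = 0 := by
  have : IsLocalMin W a := by
    refine Filter.Eventually.of_forall fun v => ?_
    by_cases h : v = a
    · rw [h]
    · rw [hWa]; exact (hWpos v h).le
  simp [gradient, this.fderiv_eq_zero]

lemma aux_lower {m : ℕ} (W : EuclideanSpace ℝ (Fin m) → ℝ) (hW : ContDiff ℝ 2 W)
    (a : EuclideanSpace ℝ (Fin m))
    (hWa : W a = 0) (hWpos : ∀ v, v ≠ a → 0 < W v)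
    (hHess : ∀ ν : EuclideanSpace ℝ (Fin m), ‖ν‖ = 1 →
      0 < ⟪fderiv ℝ (fun v => gradient W v) a ν, ν⟫) (M : ℝ) :
    ∃ c > 0, ∀ v, ‖v - a‖ ≤ M → c * ‖v - a‖ ^ 2 ≤ W v := by
  set A := fderiv ℝ (fun v => gradient W v) a with hA
  have hA' : HasFDerivAt (fun v => gradient W v) A a :=
    ((aux_grad_deriv W hW).differentiable (by norm_num) a).hasFDerivAt
  obtain ⟨c, hc, hcA⟩ : ∃ c > 0, ∀ h, 2 * c * ‖h‖ ^ 2 ≤ ⟪A h, h⟫ := by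
    obtain ⟨c, hc, hcb⟩ : ∃ c > 0, ∀ ν ∈ sphere (0 : EuclideanSpace ℝ (Fin m)) 1,
        c ≤ ⟪A ν, ν⟫ :=
      (isCompact_sphere _ _).exists_forall_le' (f := fun ν => ⟪A ν, ν⟫) (by fun_prop)
        (fun ν hν => hHess ν (by simpa using hν))
    refine ⟨c / 2, by positivity, fun h => ?_⟩
    by_cases hh : h = 0
    · simp [hh]
    have hn : 0 < ‖h‖ := norm_pos_iff.2 hh
    have := hcb (‖h‖⁻¹ • h) (by simp [norm_smul, hn.ne'])
    rw [map_smul, real_inner_smul_left, real_inner_smul_right] at this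
    have h2 : c * ‖h‖ ^ 2 ≤ (‖h‖⁻¹ * (‖h‖⁻¹ * ⟪A h, h⟫)) * ‖h‖ ^ 2 := by gcongr
    calc _ = c * ‖h‖ ^ 2 := by ring
      _ ≤ _ := h2
      _ = _ := by field_simp
  have hg0 := aux_grad_zero W a hWa hWpos
  obtain ⟨δ, hδ, hδb⟩ : ∃ δ > 0, ∀ h, ‖h‖ < δ → c * ‖h‖ ^ 2 ≤ ⟪gradient W (a + h), h⟫ := by
    have h1 := hA'.isLittleO.def hc
    rw [Metric.eventually_nhds_iff] at h1
    obtain ⟨δ, hδ, h1⟩ := h1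
    refine ⟨δ, hδ, fun h hh => ?_⟩
    have h2 := h1 (y := a + h) (by simpa [dist_eq_norm] using hh)
    simp only [hg0, add_sub_cancel_left, sub_zero] at h2
    have h3 : |⟪gradient W (a + h) - A h, h⟫| ≤ (c * ‖h‖) * ‖h‖ :=
      (abs_real_inner_le_norm _ _).trans (by gcongr)
    rw [inner_sub_left] at h3
    have := (abs_le.1 h3).1
    nlinarith [hcA h]
  have hnear : ∀ h, ‖h‖ < δ → c / 2 * ‖h‖ ^ 2 ≤ W (a + h) := by
    intro h hh
    have hd : ∀ t : ℝ, HasDerivAt (fun t : ℝ => W (a + t • h) - c / 2 * ‖h‖ ^ 2 * t ^ 2)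
        (⟪gradient W (a + t • h), h⟫ - c / 2 * ‖h‖ ^ 2 * (2 * t)) t := by
      intro t
      have := (hasDerivAt_pow 2 t).const_mul (c / 2 * ‖h‖ ^ 2)
      exact (aux_line W hW a h t).sub (by simpa using this)
    have hmono : MonotoneOn (fun t : ℝ => W (a + t • h) - c / 2 * ‖h‖ ^ 2 * t ^ 2)
        (Set.Icc 0 1) := by
      refine monotoneOn_of_deriv_nonneg (convex_Icc 0 1)
        (fun t _ => (hd t).continuousAt.continuousWithinAt)
        (fun t _ => (hd t).differentiableAt.differentiableWithinAt) ?_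
      intro t ht
      rw [interior_Icc] at ht
      rw [(hd t).deriv]
      have h1 := hδb (t • h) (by
        rw [norm_smul, Real.norm_of_nonneg ht.1.le]
        nlinarith [norm_nonneg h, ht.1, ht.2])
      rw [norm_smul, Real.norm_of_nonneg ht.1.le, real_inner_smul_right] at h1
      have h2 : t * (c * ‖h‖ ^ 2 * t) ≤ t * ⟪gradient W (a + t • h), h⟫ := by
        nlinarith
      have := le_of_mul_le_mul_left h2 ht.1
      linarith
    have := hmono (a := 0) (b := 1) (by simp) (by simp) zero_le_one
    simp [hWa] at this
    linarith
  have hK : IsCompact (closedBall a M \ ball a δ) :=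
    (isCompact_closedBall a M).diff isOpen_ball
  obtain ⟨μ, hμ, hμb⟩ : ∃ μ > 0, ∀ v ∈ closedBall a M \ ball a δ, μ ≤ W v := by
    refine hK.exists_forall_le' hW.continuous.continuousOn (fun v hv => hWpos v ?_)
    rintro rfl
    exact hv.2 (mem_ball_self hδ)
  refine ⟨min (c / 2) (μ / (M ^ 2 + 1)), by positivity, fun v hv => ?_⟩
  by_cases hvδ : ‖v - a‖ < δ
  · have := hnear (v - a) hvδ
    rw [add_sub_cancel] at this
    exact (by gcongr; exact min_le_left _ _ : _ ≤ c / 2 * ‖v - a‖ ^ 2).trans this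
  · have h1 := hμb v ⟨by simpa [dist_eq_norm] using hv, by simpa [dist_eq_norm] using hvδ⟩
    refine le_trans ?_ h1
    calc _ ≤ μ / (M ^ 2 + 1) * ‖v - a‖ ^ 2 := by gcongr; exact min_le_right _ _
      _ ≤ μ / (M ^ 2 + 1) * (M ^ 2 + 1) := by
        gcongr
        nlinarith [norm_nonneg (v - a)]
      _ = μ := by field_simp

lemma aux_upper {m : ℕ} (W : EuclideanSpace ℝ (Fin m) → ℝ) (hW : ContDiff ℝ 2 W)
    (a : EuclideanSpace ℝ (Fin m))
    (hWa : W a = 0) (hWpos : ∀ v, v ≠ a → 0 < W v) (M : ℝ) :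
    ∃ C ≥ 0, ∀ v, ‖v - a‖ ≤ M → W v ≤ C * ‖v - a‖ ^ 2 := by
  have h1 : ContDiff ℝ 1 (fderiv ℝ W) := hW.fderiv_right (by norm_num)
  have h2 : Continuous (fderiv ℝ (fderiv ℝ W)) := h1.continuous_fderiv (by norm_num)
  have hz : fderiv ℝ W a = 0 := by
    have := aux_grad_zero W a hWa hWpos
    simpa [gradient] using this
  obtain ⟨C, hC⟩ := (isCompact_closedBall a M).exists_bound_of_continuousOn
    (f := fderiv ℝ (fderiv ℝ W)) h2.continuousOn
  refine ⟨|C|, abs_nonneg _, fun v hv => ?_⟩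
  have hM : 0 ≤ M := (norm_nonneg _).trans hv
  have h3 : ∀ y ∈ closedBall a M, ‖fderiv ℝ W y‖ ≤ |C| * ‖y - a‖ := by
    intro y hy
    have := (convex_closedBall a M).norm_image_sub_le_of_norm_fderiv_le
      (f := fderiv ℝ W) (C := |C|) (fun x _ => h1.differentiable (by norm_num) x)
      (fun x hx => (hC x hx).trans (le_abs_self _)) (mem_closedBall_self hM) hy
    simpa [hz] using this
  have h4 := (convex_closedBall a ‖v - a‖).norm_image_sub_le_of_norm_fderiv_le
      (f := W) (C := |C| * ‖v - a‖) (x := a) (y := v)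
      (fun x _ => hW.differentiable (by norm_num) x)
      (fun x hx => by
        have hx' : ‖x - a‖ ≤ ‖v - a‖ := by simpa [dist_eq_norm] using hx
        refine (h3 x (by simpa [dist_eq_norm] using hx'.trans hv)).trans (by gcongr))
      (by simp) (by simp [dist_eq_norm])
  rw [hWa, sub_zero] at h4
  calc W v ≤ ‖W v‖ := le_abs_self _
    _ ≤ _ := h4
    _ = _ := by ring

/-- A smooth substitute for the norm. -/
noncomputable def auxRho {n : ℕ} (x : EuclideanSpace ℝ (Fin n)) : ℝ := Real.sqrt (1 + ‖x‖ ^ 2)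

lemma auxRho_contDiff {n : ℕ} : ContDiff ℝ 2 (auxRho (n := n)) := by
  unfold auxRho
  exact (contDiff_const.add (contDiff_norm_sq ℝ)).sqrt (fun x => by positivity)

lemma auxRho_norm_le {n : ℕ} (x : EuclideanSpace ℝ (Fin n)) : ‖x‖ ≤ auxRho x := by
  unfold auxRho
  exact Real.le_sqrt_of_sq_le (by linarith)

lemma auxRho_lip {n : ℕ} : LipschitzWith 1 (auxRho (n := n)) := by
  refine LipschitzWith.of_le_add fun x y => ?_
  rw [dist_eq_norm]
  unfold auxRho
  have hx : ‖x‖ ≤ ‖y‖ + ‖x - y‖ := by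
    calc ‖x‖ = ‖y + (x - y)‖ := by congr 1; abel
      _ ≤ _ := norm_add_le _ _
  have h1 : ‖y‖ ≤ Real.sqrt (1 + ‖y‖ ^ 2) := auxRho_norm_le y
  have h2 := Real.sq_sqrt (show 0 ≤ 1 + ‖y‖ ^ 2 by positivity)
  apply Real.sqrt_le_iff.2
  refine ⟨by positivity, ?_⟩
  have h3 : ‖x‖ ^ 2 ≤ (‖y‖ + ‖x - y‖) ^ 2 := by gcongr
  nlinarith [norm_nonneg (x - y)]

lemma aux_h_bound : ∃ K : NNReal, LipschitzWith K Real.smoothTransition := by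
  have hc : ContDiff ℝ 1 Real.smoothTransition := Real.smoothTransition.contDiff
  have hd : Continuous (deriv Real.smoothTransition) := hc.continuous_deriv (by norm_num)
  obtain ⟨C, hC⟩ := (isCompact_Icc (a := (0:ℝ)) (b := 1)).exists_bound_of_continuousOn
    hd.continuousOn
  refine ⟨Real.toNNReal |C|, lipschitzWith_of_nnnorm_deriv_le (hc.differentiable (by norm_num))
    fun x => ?_⟩
  rw [← NNReal.coe_le_coe, coe_nnnorm, Real.coe_toNNReal _ (abs_nonneg _)]
  by_cases hx : x ∈ Set.Icc (0:ℝ) 1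
  · exact (hC x hx).trans (le_abs_self _)
  · rw [Set.mem_Icc, not_and_or, not_le, not_le] at hx
    have : deriv Real.smoothTransition x = 0 := by
      rcases hx with hx | hx
      · have : Real.smoothTransition =ᶠ[nhds x] fun _ => 0 := by
          filter_upwards [gt_mem_nhds hx] with y hy
          exact Real.smoothTransition.zero_of_nonpos hy.le
        rw [this.deriv_eq]; simp
      · have : Real.smoothTransition =ᶠ[nhds x] fun _ => 1 := by
          filter_upwards [lt_mem_nhds hx] with y hy
          exact Real.smoothTransition.one_of_one_le hy.le
        rw [this.deriv_eq]; simp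
    rw [this]; simp

lemma aux_vec {E : Type*} [NormedAddCommGroup E] [NormedSpace ℝ E] (p w : E) (s d K : ℝ)
    (hs0 : 0 ≤ s) (hs1 : s ≤ 1) (hd : |d| ≤ K) :
    ‖(1 - s ^ 2) • p - (2 * s * d) • w‖ ^ 2 ≤ ‖p‖ ^ 2 + 8 * K ^ 2 * ‖w‖ ^ 2 := by
  have h1 : ‖(1 - s ^ 2) • p - (2 * s * d) • w‖ ≤ (1 - s ^ 2) * ‖p‖ + (2 * s * K) * ‖w‖ := by
    refine (norm_sub_le _ _).trans ?_
    rw [norm_smul, norm_smul, Real.norm_of_nonneg (by nlinarith : 0 ≤ 1 - s ^ 2),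
      Real.norm_eq_abs, abs_mul, abs_of_nonneg (by positivity : 0 ≤ 2 * s)]
    gcongr
  have hK : 0 ≤ K := (abs_nonneg d).trans hd
  set P := ‖p‖
  set Q := K * ‖w‖ with hQ
  have hP : 0 ≤ P := norm_nonneg _
  have hQ0 : 0 ≤ Q := by positivity
  have h2 : ‖(1 - s ^ 2) • p - (2 * s * d) • w‖ ^ 2 ≤ ((1 - s ^ 2) * P + 2 * s * Q) ^ 2 := by
    have : (1 - s ^ 2) * P + 2 * s * Q = (1 - s ^ 2) * P + (2 * s * K) * ‖w‖ := by
      rw [hQ]; ring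
    rw [this]; gcongr
  refine h2.trans ?_
  have hs2 : s ^ 2 ≤ 1 := by nlinarith
  have e : P ^ 2 + 8 * K ^ 2 * ‖w‖ ^ 2 = P ^ 2 + 8 * Q ^ 2 := by rw [hQ]; ring
  rw [e]
  have h3 : 4 * (s * P) * Q ≤ (s * P) ^ 2 + 4 * Q ^ 2 := by nlinarith [sq_nonneg (s * P - 2 * Q)]
  have h4 : (1 - s ^ 2) * (4 * (s * P) * Q) ≤ 4 * (s * P) * Q := by
    have : 0 ≤ 4 * (s * P) * Q := by positivity
    nlinarith [mul_nonneg (sq_nonneg s) this]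
  have h5 : ((1 - s ^ 2) ^ 2 + s ^ 2) * P ^ 2 ≤ 1 * P ^ 2 := by
    gcongr; nlinarith [sq_nonneg s]
  have h6 : s ^ 2 * Q ^ 2 ≤ 1 * Q ^ 2 := by gcongr
  nlinarith

lemma aux_gradSq_cont {n m : ℕ} (u : EuclideanSpace ℝ (Fin n) → EuclideanSpace ℝ (Fin m))
    (hu : ContDiff ℝ 2 u) : Continuous (gradSq u) := by
  have : Continuous (fderiv ℝ u) := hu.continuous_fderiv (by norm_num)
  unfold gradSq
  fun_prop

lemma aux_key {n m : ℕ}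
    (W : EuclideanSpace ℝ (Fin m) → ℝ) (hW : ContDiff ℝ 2 W)
    (a : EuclideanSpace ℝ (Fin m))
    (hWa : W a = 0) (hWpos : ∀ v, v ≠ a → 0 < W v)
    (hHess : ∀ ν : EuclideanSpace ℝ (Fin m), ‖ν‖ = 1 →
      0 < ⟪fderiv ℝ (fun v => gradient W v) a ν, ν⟫)
    (u : EuclideanSpace ℝ (Fin n) → EuclideanSpace ℝ (Fin m))
    (hu : ContDiff ℝ 2 u) (M : ℝ) (hM : ∀ x, ‖u x - a‖ ≤ M)
    (hmin : GloballyMinimizing W u) :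
    ∃ δ > 0, ∀ R : ℝ, (1 + δ) * ∫ x in {x | auxRho x < R}, ‖u x - a‖ ^ 2 ≤
      ∫ x in {x | auxRho x < R + 2}, ‖u x - a‖ ^ 2 := by
  obtain ⟨c, hc, hcW⟩ := aux_lower W hW a hWa hWpos hHess M
  obtain ⟨C, hC, hCW⟩ := aux_upper W hW a hWa hWpos M
  obtain ⟨K, hK⟩ := aux_h_bound
  set C' : ℝ := C + n * (4 * K ^ 2) + 1 with hC'
  have hC'0 : 0 < C' := by positivity
  refine ⟨c / C', by positivity, fun R => ?_⟩
  have hρc : Continuous (auxRho (n := n)) := auxRho_contDiff.continuous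
  set η : EuclideanSpace ℝ (Fin n) → ℝ := fun x => Real.smoothTransition (R + 1 - auxRho x) with hη
  have hηc : ContDiff ℝ 2 η :=
    Real.smoothTransition.contDiff.comp (contDiff_const.sub auxRho_contDiff)
  have hηL : LipschitzWith K η := by
    refine LipschitzWith.of_dist_le_mul fun x y => ?_
    refine (hK.dist_le_mul _ _).trans ?_
    have := auxRho_lip.dist_le_mul x y
    rw [dist_sub_left]
    gcongr
    simpa using this
  have hηd : ∀ x i, |fderiv ℝ η x (EuclideanSpace.single i 1)| ≤ K := by
    intro x i
    have h1 := norm_fderiv_le_of_lipschitz ℝ hηL (x₀ := x)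
    have h2 := (fderiv ℝ η x).le_opNorm (EuclideanSpace.single i 1)
    simp at h2
    exact h2.trans h1
  have hη0 : ∀ x, 0 ≤ η x := fun x => Real.smoothTransition.nonneg _
  have hη1 : ∀ x, η x ≤ 1 := fun x => Real.smoothTransition.le_one _
  set φ : EuclideanSpace ℝ (Fin n) → EuclideanSpace ℝ (Fin m) :=
    fun x => - ((η x) ^ 2 • (u x - a)) with hφ
  have hφc : ContDiff ℝ 2 φ := ((hηc.pow 2).smul (hu.sub contDiff_const)).neg
  have hbd : ∀ r : ℝ, {x : EuclideanSpace ℝ (Fin n) | auxRho x ≤ r} ⊆ closedBall 0 r := by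
    intro r x hx
    simpa using (auxRho_norm_le x).trans hx
  have hts : tsupport φ ⊆ {x | auxRho x ≤ R + 1} := by
    refine closure_minimal ?_ (isClosed_le hρc continuous_const)
    intro x hx
    by_contra hcon
    apply hx
    have : η x = 0 := Real.smoothTransition.zero_of_nonpos (by
      have : R + 1 < auxRho x := not_le.1 hcon
      linarith)
    simp [hφ, this]
  have hφK : HasCompactSupport φ :=
    (isCompact_closedBall 0 (R + 1)).of_isClosed_subset (isClosed_tsupport φ)
      (hts.trans (hbd _))
  have hφL : ∃ L : NNReal, LipschitzWith L φ :=
    hφc.lipschitzWith_of_hasCompactSupport hφK (by norm_num)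
  set Ω : Set (EuclideanSpace ℝ (Fin n)) := {x | auxRho x < R + 2} with hΩ
  set S : Set (EuclideanSpace ℝ (Fin n)) := {x | auxRho x < R} with hS
  have hΩo : IsOpen Ω := isOpen_lt hρc continuous_const
  have hSo : IsOpen S := isOpen_lt hρc continuous_const
  have hΩb : Ω ⊆ closedBall 0 (R + 2) := fun x hx => hbd _ (le_of_lt hx : auxRho x ≤ R + 2)
  have hSΩ : S ⊆ Ω := fun x hx => lt_trans hx (by linarith : R < R + 2)
  have hE := hmin Ω hΩo (isBounded_closedBall.subset hΩb) φ hφL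
    (hts.trans fun x hx => lt_of_le_of_lt hx (by linarith : R + 1 < R + 2))
  have hIntegr : ∀ f : EuclideanSpace ℝ (Fin n) → ℝ, Continuous f → IntegrableOn f Ω :=
    fun f hf => (hf.continuousOn.integrableOn_compact (isCompact_closedBall 0 (R + 2))).mono_set hΩb
  have hvc : ContDiff ℝ 2 (u + φ) := hu.add hφc
  have hveq : ∀ x, (u + φ) x - a = (1 - η x ^ 2) • (u x - a) := by
    intro x
    simp only [Pi.add_apply, hφ, sub_smul, one_smul]
    abel
  have hvM : ∀ x, ‖(u + φ) x - a‖ ≤ ‖u x - a‖ := by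
    intro x
    rw [hveq, norm_smul]
    have : 0 ≤ 1 - η x ^ 2 := by nlinarith [hη0 x, hη1 x]
    rw [Real.norm_of_nonneg this]
    nlinarith [norm_nonneg (u x - a), sq_nonneg (η x)]
  have hW0 : ∀ v, 0 ≤ W v := by
    intro v
    by_cases h : v = a
    · rw [h, hWa]
    · exact (hWpos v h).le
  -- pointwise bounds
  have hgen : ∀ x, (1 / 2) * gradSq (u + φ) x + W ((u + φ) x) -
      ((1 / 2) * gradSq u x + W (u x)) ≤ C' * ‖u x - a‖ ^ 2 := by
    intro x
    have hder : ∀ i, fderiv ℝ (u + φ) x (EuclideanSpace.single i 1) =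
        (1 - η x ^ 2) • fderiv ℝ u x (EuclideanSpace.single i 1)
          - (2 * η x * fderiv ℝ η x (EuclideanSpace.single i 1)) • (u x - a) := by
      intro i
      have hdu : HasFDerivAt u (fderiv ℝ u x) x := (hu.differentiable (by norm_num) x).hasFDerivAt
      have hdη : HasFDerivAt η (fderiv ℝ η x) x := (hηc.differentiable (by norm_num) x).hasFDerivAt
      have h := hdu.add (((hdη.pow 2).smul (hdu.sub_const a)).neg)
      have h' : HasFDerivAt (u + φ) _ x := h
      rw [h'.fderiv]
      simp [sub_smul]
      abel
    have hg : gradSq (u + φ) x ≤ gradSq u x + n * (8 * K ^ 2 * ‖u x - a‖ ^ 2) := by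
      unfold gradSq
      calc _ ≤ ∑ i : Fin n, (‖fderiv ℝ u x (EuclideanSpace.single i 1)‖ ^ 2 +
            8 * K ^ 2 * ‖u x - a‖ ^ 2) := by
            refine Finset.sum_le_sum fun i _ => ?_
            rw [hder i]
            exact aux_vec _ _ _ _ _ (hη0 x) (hη1 x) (hηd x i)
        _ = _ := by simp [Finset.sum_add_distrib]
    have h2 : W ((u + φ) x) ≤ C * ‖u x - a‖ ^ 2 := by
      refine (hCW _ ((hvM x).trans (hM x))).trans ?_
      have := hvM x
      gcongr
    have h3 := hW0 (u x)
    rw [hC']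
    nlinarith [sq_nonneg ‖u x - a‖]
  have hin : ∀ x ∈ S, (1 / 2) * gradSq (u + φ) x + W ((u + φ) x) -
      ((1 / 2) * gradSq u x + W (u x)) ≤ - (c * ‖u x - a‖ ^ 2) := by
    intro x hx
    have hloc : (u + φ) =ᶠ[nhds x] fun _ => a := by
      filter_upwards [hSo.mem_nhds hx] with y hy
      have : η y = 1 := Real.smoothTransition.one_of_one_le (by
        have : auxRho y < R := hy
        linarith)
      have h2 := hveq y
      rw [this] at h2
      simpa [sub_eq_zero] using h2
    have h1 : gradSq (u + φ) x = 0 := by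
      unfold gradSq
      rw [hloc.fderiv_eq]
      simp
    have h2 : 0 ≤ gradSq u x := by unfold gradSq; positivity
    rw [h1, hloc.eq_of_nhds, hWa]
    have := hcW (u x) (hM x)
    linarith
  -- integrate
  have hcu : Continuous fun x => (1 / 2) * gradSq u x + W (u x) :=
    ((aux_gradSq_cont u hu).const_mul _).add (hW.continuous.comp hu.continuous)
  have hcv : Continuous fun x => (1 / 2) * gradSq (u + φ) x + W ((u + φ) x) :=
    ((aux_gradSq_cont _ hvc).const_mul _).add (hW.continuous.comp hvc.continuous)
  have hcw : Continuous fun x => ‖u x - a‖ ^ 2 :=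
    ((hu.continuous.sub continuous_const).norm.pow 2)
  unfold energy at hE
  have hI : 0 ≤ ∫ x in Ω, ((1 / 2) * gradSq (u + φ) x + W ((u + φ) x) -
      ((1 / 2) * gradSq u x + W (u x))) := by
    rw [integral_sub (hIntegr _ hcv) (hIntegr _ hcu)]
    linarith
  have hsplit : ∀ f : EuclideanSpace ℝ (Fin n) → ℝ, Continuous f →
      ∫ x in Ω, f x = (∫ x in S, f x) + ∫ x in Ω \ S, f x := by
    intro f hf
    have h := setIntegral_union (f := f) (μ := volume) (s := S) (t := Ω \ S)
      Set.disjoint_sdiff_right (hΩo.measurableSet.diff hSo.measurableSet)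
      ((hIntegr f hf).mono_set hSΩ) ((hIntegr f hf).mono_set Set.sdiff_subset)
    rw [Set.union_sdiff_cancel hSΩ] at h
    exact h
  have hcd : Continuous fun x => (1 / 2) * gradSq (u + φ) x + W ((u + φ) x) -
      ((1 / 2) * gradSq u x + W (u x)) := hcv.sub hcu
  rw [hsplit _ hcd] at hI
  have hI1 : ∫ x in S, ((1 / 2) * gradSq (u + φ) x + W ((u + φ) x) -
      ((1 / 2) * gradSq u x + W (u x))) ≤ ∫ x in S, - (c * ‖u x - a‖ ^ 2) :=
    setIntegral_mono_on ((hIntegr _ hcd).mono_set hSΩ)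
      ((hIntegr _ (hcw.const_mul c).neg).mono_set hSΩ) hSo.measurableSet hin
  have hI2 : ∫ x in Ω \ S, ((1 / 2) * gradSq (u + φ) x + W ((u + φ) x) -
      ((1 / 2) * gradSq u x + W (u x))) ≤ ∫ x in Ω \ S, C' * ‖u x - a‖ ^ 2 :=
    setIntegral_mono_on ((hIntegr _ hcd).mono_set Set.sdiff_subset)
      ((hIntegr _ (hcw.const_mul C')).mono_set Set.sdiff_subset)
      (hΩo.measurableSet.diff hSo.measurableSet) (fun x _ => hgen x)
  rw [integral_neg, integral_const_mul] at hI1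
  rw [integral_const_mul] at hI2
  rw [hsplit _ hcw]
  set G := ∫ x in S, ‖u x - a‖ ^ 2
  set H := ∫ x in Ω \ S, ‖u x - a‖ ^ 2
  have h1 : c * G ≤ C' * H := by linarith
  have h2 : c / C' * G ≤ H := by
    rw [div_mul_eq_mul_div, div_le_iff₀ hC'0]; linarith
  linarith

/-- Theorem 1.3, Case (c): if `W ∈ C²` has positive definite Hessian at `a`
(`W_{uu}(a)ν·ν > 0` for every unit `ν`), then any bounded globally minimizing
solution is identically `a`. -/
theorem liouville_nondegenerate
    (n m : ℕ) (hn : 2 ≤ n) (hm : 1 ≤ m)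
    (W : EuclideanSpace ℝ (Fin m) → ℝ) (hW : ContDiff ℝ 2 W)
    (a : EuclideanSpace ℝ (Fin m))
    (hWa : W a = 0) (hWpos : ∀ v, v ≠ a → 0 < W v)
    (hHess : ∀ ν : EuclideanSpace ℝ (Fin m), ‖ν‖ = 1 →
      0 < ⟪fderiv ℝ (fun v => gradient W v) a ν, ν⟫)
    (u : EuclideanSpace ℝ (Fin n) → EuclideanSpace ℝ (Fin m))
    (hu : ContDiff ℝ 2 u)
    (hbdd : ∃ C, ∀ x, ‖u x‖ ≤ C)
    (hsol : ∀ x, vlap u x = gradient W (u x))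
    (hmin : GloballyMinimizing W u) :
    ∀ x, u x = a := by
  obtain ⟨C, hC⟩ := hbdd
  set M := C + ‖a‖ with hMdef
  have hM : ∀ x, ‖u x - a‖ ≤ M := fun x => (norm_sub_le _ _).trans (by linarith [hC x])
  obtain ⟨δ, hδ, hkey⟩ := aux_key W hW a hWa hWpos hHess u hu M hM hmin
  have hρc : Continuous (auxRho (n := n)) := auxRho_contDiff.continuous
  have hcw : Continuous fun x => ‖u x - a‖ ^ 2 :=
    ((hu.continuous.sub continuous_const).norm.pow 2)
  intro x₀
  set R := auxRho x₀ + 1 with hR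
  have hRpos : 0 < R := by
    have : 0 ≤ auxRho x₀ := Real.sqrt_nonneg _
    linarith
  set G : ℝ → ℝ := fun r => ∫ x in {x | auxRho x < r}, ‖u x - a‖ ^ 2 with hG
  have hsub : ∀ r : ℝ, {x : EuclideanSpace ℝ (Fin n) | auxRho x < r} ⊆ closedBall 0 r := by
    intro r x hx
    simpa using (auxRho_norm_le x).trans (le_of_lt hx)
  have hG0 : ∀ r, 0 ≤ G r := fun r => integral_nonneg fun x => by positivity
  have hgrow : ∀ k : ℕ, (1 + δ) ^ k * G R ≤ G (R + 2 * k) := by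
    intro k
    induction k with
    | zero => simp
    | succ k ih =>
      have h1 := hkey (R + 2 * k)
      have h2 : (1 + δ) * ((1 + δ) ^ k * G R) ≤ (1 + δ) * G (R + 2 * k) := by gcongr
      have e : R + 2 * ((k + 1 : ℕ) : ℝ) = R + 2 * k + 2 := by push_cast; ring
      rw [e, pow_succ]
      calc _ = (1 + δ) * ((1 + δ) ^ k * G R) := by ring
        _ ≤ _ := h2
        _ ≤ _ := h1
  set V := volume.real (closedBall (0 : EuclideanSpace ℝ (Fin n)) 1) with hV
  have hupper : ∀ r, 0 ≤ r → G r ≤ M ^ 2 * (r ^ n * V) := by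
    intro r hr
    have hi : IntegrableOn (fun x => ‖u x - a‖ ^ 2) (closedBall 0 r) :=
      hcw.continuousOn.integrableOn_compact (isCompact_closedBall 0 r)
    calc G r ≤ ∫ x in closedBall 0 r, ‖u x - a‖ ^ 2 :=
          setIntegral_mono_set hi (Filter.Eventually.of_forall fun x => by positivity)
            (hsub r).eventuallyLE
      _ ≤ ∫ x in closedBall (0 : EuclideanSpace ℝ (Fin n)) r, M ^ 2 := by
          refine setIntegral_mono_on hi ?_ measurableSet_closedBall fun x _ => ?_
          · exact continuousOn_const.integrableOn_compact (isCompact_closedBall 0 r)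
          · have := hM x
            gcongr
      _ = M ^ 2 * (r ^ n * V) := by
          rw [setIntegral_const, smul_eq_mul, hV, Measure.real,
            Measure.addHaar_closedBall' volume _ hr]
          simp [Measure.real, ENNReal.toReal_mul, hr]
          ring
  have hGR : G R = 0 := by
    refine le_antisymm ?_ (hG0 R)
    have hlim : Tendsto (fun k : ℕ => M ^ 2 * ((R + 2) ^ n * V) * ((k : ℝ) ^ n / (1 + δ) ^ k))
        atTop (nhds (M ^ 2 * ((R + 2) ^ n * V) * 0)) :=
      (tendsto_pow_const_div_const_pow_of_one_lt n (by linarith)).const_mul _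
    rw [mul_zero] at hlim
    refine ge_of_tendsto hlim ?_
    filter_upwards [eventually_ge_atTop 1] with k hk
    have hk' : (1 : ℝ) ≤ k := by exact_mod_cast hk
    have h1 := (hgrow k).trans (hupper (R + 2 * k) (by positivity))
    have hp : 0 < (1 + δ) ^ k := by positivity
    have hV0 : 0 ≤ V := measureReal_nonneg
    rw [← mul_div_assoc, le_div_iff₀ hp]
    calc G R * (1 + δ) ^ k = (1 + δ) ^ k * G R := mul_comm _ _
      _ ≤ _ := h1
      _ ≤ M ^ 2 * (((R + 2) * k) ^ n * V) := by
        gcongr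
        nlinarith
      _ = _ := by rw [mul_pow]; ring
  by_contra hne
  have hSo : IsOpen {x : EuclideanSpace ℝ (Fin n) | auxRho x < R} :=
    isOpen_lt hρc continuous_const
  have hi : IntegrableOn (fun x => ‖u x - a‖ ^ 2) {x | auxRho x < R} :=
    (hcw.continuousOn.integrableOn_compact (isCompact_closedBall 0 R)).mono_set (hsub R)
  have hae := (setIntegral_eq_zero_iff_of_nonneg_ae
    (Filter.Eventually.of_forall fun x => by positivity) hi).1 hGR
  have heq := Measure.eqOn_open_of_ae_eq hae hSo hcw.continuousOn continuousOn_const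
  have := heq (x := x₀) (by simp [hR])
  simp [sub_eq_zero] at this
  exact hne this
end
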